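/- arXiv:1609.02250 — 2 statements merged into one kernel-verified Lean document; each statement's English description precedes it below -/
import Mathlib

section
/- The GL_5-invariants of QP_5((3,4,3)) vanish: if f is an F_2-linear combination of monomials of degree 23 whose weight vectors are ≤ (3,4,3,0,...) in left lexicographic order, and for every g in GL_5(F_2) the polynomial g·f − f is the sum of a hit polynomial and an element of P_5^−((3,4,3)), then f itself is the sum of a hit polynomial and an element of P_5^−((3,4,3)). -/
open MvPolynomial

noncomputable section

/-- The polynomial algebra `P_5 = F_2[x_1,...,x_5]`. -/
abbrev P5 : Type := MvPolynomial (Fin 5) (ZMod 2)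

/-- The total Steenrod square: the `F_2`-algebra endomorphism with `Sq (x_i) = x_i + x_i ^ 2`. -/
def Sq : P5 →ₐ[ZMod 2] P5 := aeval fun i => X i + X i ^ 2

/-- `f` (homogeneous of degree `n`) is hit if it is the degree-`n` homogeneous component of
`Sq g` for some `g` all of whose homogeneous components have degree `< n`. -/
def IsHit (n : ℕ) (f : P5) : Prop :=
  ∃ g : P5, (∀ m, n ≤ m → homogeneousComponent m g = 0) ∧
    f = homogeneousComponent n (Sq g)

/-- The subspace of hit polynomials of degree `n`. -/
def hitSpan (n : ℕ) : Submodule (ZMod 2) P5 :=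
  Submodule.span (ZMod 2) {f : P5 | IsHit n f}

/-- The action of `GL_5(F_2)` on `P_5` by linear substitution of the variables. -/
def actGL (g : Matrix.GeneralLinearGroup (Fin 5) (ZMod 2)) : P5 →ₐ[ZMod 2] P5 :=
  aeval fun i => ∑ j, ((g : Matrix (Fin 5) (Fin 5) (ZMod 2)) i j) • X j

/-- `wt d i` is the `(i+1)`-st entry `ω_{i+1}` of the weight vector of the monomial with
exponent vector `d`, i.e. the number of `j` such that bit `i` of `d j` is `1`. -/
def wt (d : Fin 5 →₀ ℕ) (i : ℕ) : ℕ :=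
  (Finset.univ.filter fun j : Fin 5 => Nat.testBit (d j) i).card

/-- The weight vector of the exponent vector `d` equals the (finitely supported) list `w`. -/
def hasWt (d : Fin 5 →₀ ℕ) (w : List ℕ) : Prop :=
  ∀ i, wt d i = w.getD i 0

/-- The weight vector of `d` is strictly smaller than `w` in left lexicographic order. -/
def wtLt (d : Fin 5 →₀ ℕ) (w : List ℕ) : Prop :=
  ∃ i, (∀ j, j < i → wt d j = w.getD j 0) ∧ wt d i < w.getD i 0

/-- `P_5^-(ω)`: the span of degree-`n` monomials whose weight vector is `< w`. -/
def PMinus (n : ℕ) (w : List ℕ) : Submodule (ZMod 2) P5 :=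
  Submodule.span (ZMod 2)
    {x : P5 | ∃ d : Fin 5 →₀ ℕ, x = monomial d 1 ∧ (∑ j, d j) = n ∧ wtLt d w}

/-- `P_5(ω)`: the span of degree-`n` monomials whose weight vector is `≤ w`. -/
def PLe (n : ℕ) (w : List ℕ) : Submodule (ZMod 2) P5 :=
  Submodule.span (ZMod 2)
    {x : P5 | ∃ d : Fin 5 →₀ ℕ, x = monomial d 1 ∧ (∑ j, d j) = n ∧ (wtLt d w ∨ hasWt d w)}

/-- The monomial `x_1^a x_2^b x_3^c x_4^d x_5^e`. -/
def mon (a b c d e : ℕ) : P5 :=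
  X 0 ^ a * X 1 ^ b * X 2 ^ c * X 3 ^ d * X 4 ^ e

/-- The polynomials of degree `23` which are sums of a hit polynomial and an element of
`P_5^-((3,4,3))`. -/
def hitMod : Submodule (ZMod 2) P5 where
  carrier := {f | ∃ h p : P5, IsHit 23 h ∧ p ∈ PMinus 23 [3, 4, 3] ∧ f = h + p}
  zero_mem' := ⟨0, 0, ⟨0, by simp⟩, zero_mem _, by simp⟩
  add_mem' := by
    rintro _ _ ⟨h, p, ⟨u, hu, rfl⟩, hp, rfl⟩ ⟨h', p', ⟨u', hu', rfl⟩, hp', rfl⟩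
    refine ⟨_, p + p', ⟨u + u', fun m hm => by simp [hu m hm, hu' m hm], rfl⟩,
      add_mem hp hp', ?_⟩
    simp only [map_add]
    abel
  smul_mem' := by
    rintro c _ ⟨h, p, ⟨u, hu, rfl⟩, hp, rfl⟩
    exact ⟨_, c • p, ⟨c • u, fun m hm => by simp [hu m hm], rfl⟩, Submodule.smul_mem _ _ hp,
      by simp⟩

theorem mem_hitMod_of_isHit {h : P5} (hh : IsHit 23 h) : h ∈ hitMod :=
  ⟨h, 0, hh, zero_mem _, by simp⟩

theorem mem_hitMod_of_mem_PMinus {p : P5} (hp : p ∈ PMinus 23 [3, 4, 3]) : p ∈ hitMod :=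
  ⟨0, p, ⟨0, by simp⟩, hp, by simp⟩

theorem Sq_X (i : Fin 5) : Sq (X i) = X i + X i ^ 2 := by simp [Sq]

theorem actGL_X (g : Matrix.GeneralLinearGroup (Fin 5) (ZMod 2)) (i : Fin 5) :
    actGL g (X i) = ∑ j, (g : Matrix (Fin 5) (Fin 5) (ZMod 2)) i j • X j := by simp [actGL]

theorem add_sq_P5 (x y : P5) : (x + y) ^ 2 = x ^ 2 + y ^ 2 := CharTwo.add_sq x y

theorem Sq_actGL (g : Matrix.GeneralLinearGroup (Fin 5) (ZMod 2)) (f : P5) :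
    Sq (actGL g f) = actGL g (Sq f) := by
  have : Sq.comp (actGL g) = (actGL g).comp Sq := by
    refine MvPolynomial.algHom_ext fun i => ?_
    have hc : ∀ c : ZMod 2, c ^ 2 = c := by decide
    simp only [AlgHom.comp_apply, Sq_X, map_add, map_pow, actGL_X, map_sum, map_smul, smul_add,
      Finset.sum_add_distrib, CharTwo.sum_sq, smul_pow, hc]
  exact DFunLike.congr_fun this f

theorem isHomogeneous_actGL (g : Matrix.GeneralLinearGroup (Fin 5) (ZMod 2)) {f : P5} {n : ℕ}
    (hf : f.IsHomogeneous n) : (actGL g f).IsHomogeneous n := by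
  have := hf.aeval (fun i => ∑ j, (g : Matrix (Fin 5) (Fin 5) (ZMod 2)) i j • (X j : P5)) (n := 1)
    fun i => IsHomogeneous.sum _ _ _ fun j _ =>
      (homogeneousSubmodule (Fin 5) (ZMod 2) 1).smul_mem _ (isHomogeneous_X _ j)
  simpa [actGL] using this

theorem homogeneousComponent_actGL (g : Matrix.GeneralLinearGroup (Fin 5) (ZMod 2)) (n : ℕ)
    (f : P5) : homogeneousComponent n (actGL g f) = actGL g (homogeneousComponent n f) := by
  conv_lhs => rw [← sum_homogeneousComponent f]
  simp only [map_sum]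
  rw [Finset.sum_congr rfl fun i _ => homogeneousComponent_of_mem
    (isHomogeneous_actGL g (homogeneousComponent_isHomogeneous i f))]
  by_cases h : f.totalDegree < n
  · rw [homogeneousComponent_eq_zero n f h, map_zero]
    exact Finset.sum_eq_zero fun i hi => if_neg (by have := Finset.mem_range.mp hi; omega)
  · rw [Finset.sum_ite_eq, if_pos (Finset.mem_range.mpr (by omega))]

theorem isHit_actGL (g : Matrix.GeneralLinearGroup (Fin 5) (ZMod 2)) {n : ℕ} {h : P5}
    (hh : IsHit n h) : IsHit n (actGL g h) := by
  obtain ⟨u, hu, rfl⟩ := hh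
  refine ⟨actGL g u, fun m hm => ?_, ?_⟩
  · rw [homogeneousComponent_actGL, hu m hm, map_zero]
  · rw [Sq_actGL, homogeneousComponent_actGL]

/-- An additive map is controlled on homogeneous polynomials by its values on monomials. -/
theorem map_mem_of_isHomogeneous {n : ℕ} (F : P5 → P5) (hF : ∀ x y, F (x + y) = F x + F y)
    (S : Submodule (ZMod 2) P5) (h : ∀ d : Fin 5 →₀ ℕ, d.degree = n → F (monomial d 1) ∈ S)
    {f : P5} (hf : f.IsHomogeneous n) : F f ∈ S := by
  let F' : P5 →+ P5 := AddMonoidHom.mk' F hF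
  change F' f ∈ S
  rw [f.as_sum, map_sum]
  refine sum_mem fun d hd => ?_
  have h1 : coeff d f = 1 := by
    have h2 := mem_support_iff.mp hd
    revert h2
    generalize coeff d f = c
    revert c
    decide
  rw [h1]
  refine h d ?_
  by_contra hne
  exact mem_support_iff.mp hd (hf.coeff_eq_zero hne)

theorem wt_zero_add_two_mul (e d : Fin 5 →₀ ℕ) : wt (e + 2 • d) 0 = wt e 0 := by
  unfold wt
  congr 1
  ext j
  simp [Nat.testBit_zero]

theorem wt_zero_le (e : Fin 5 →₀ ℕ) : wt e 0 ≤ e.degree := by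
  rw [wt, Finset.card_filter, Finsupp.degree_eq_sum]
  refine Finset.sum_le_sum fun j _ => ?_
  simp only [Nat.testBit_zero, decide_eq_true_eq]
  split_ifs <;> omega

theorem wt_succ_of_wt_zero_eq {e : Fin 5 →₀ ℕ} (d : Fin 5 →₀ ℕ) (h : wt e 0 = e.degree) (i : ℕ) :
    wt (e + 2 • d) (i + 1) = wt d i := by
  rw [wt, Finset.card_filter, Finsupp.degree_eq_sum] at h
  have h1 := (Finset.sum_eq_sum_iff_of_le fun j _ => by
    simp only [Nat.testBit_zero, decide_eq_true_eq]
    split_ifs <;> omega).mp h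
  unfold wt
  congr 1
  ext j
  have h2 := h1 j (Finset.mem_univ j)
  have h3 : e j ≤ 1 := by rw [← h2]; split_ifs <;> omega
  have h4 : (e j + 2 * d j) / 2 = d j := by omega
  simp [Nat.testBit_succ, h4]

theorem wtLt_of_degree {e0 e1 e2 e3 : Fin 5 →₀ ℕ}
    (h : e0.degree < 3 ∨ e0.degree = 3 ∧ e1.degree < 4 ∨
      e0.degree = 3 ∧ e1.degree = 4 ∧ e2.degree < 3) :
    wtLt (e0 + 2 • (e1 + 2 • (e2 + 2 • e3))) [3, 4, 3] := by
  have w0 := wt_zero_add_two_mul e0 (e1 + 2 • (e2 + 2 • e3))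
  have w1 := wt_zero_add_two_mul e1 (e2 + 2 • e3)
  have w2 := wt_zero_add_two_mul e2 e3
  have l0 := wt_zero_le e0
  have l1 := wt_zero_le e1
  have l2 := wt_zero_le e2
  by_cases c0 : wt e0 0 < 3
  · exact ⟨0, by simp, w0.trans_lt c0⟩
  have s0 := wt_succ_of_wt_zero_eq (e := e0) (e1 + 2 • (e2 + 2 • e3)) (by omega)
  have w0' : wt (e0 + 2 • (e1 + 2 • (e2 + 2 • e3))) 0 = 3 := by omega
  have w1' := (s0 0).trans w1
  by_cases c1 : wt e1 0 < 4
  · refine ⟨1, fun j hj => ?_, w1'.trans_lt c1⟩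
    obtain rfl : j = 0 := by omega
    exact w0'
  have s1 := wt_succ_of_wt_zero_eq (e := e1) (e2 + 2 • e3) (by omega)
  refine ⟨2, fun j hj => ?_, (((s0 1).trans (s1 0)).trans w2).trans_lt ?_⟩
  · interval_cases j
    · exact w0'
    · exact w1'.trans (show wt e1 0 = 4 by omega)
  · change wt e2 0 < 3
    omega

theorem monomial_eq_mul (e0 e1 e2 e3 : Fin 5 →₀ ℕ) :
    (monomial (e0 + 2 • (e1 + 2 • (e2 + 2 • e3))) 1 : P5) =
      monomial e0 1 * monomial e1 1 ^ 2 * monomial e2 1 ^ 4 * monomial e3 1 ^ 8 := by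
  simp only [monomial_pow, monomial_mul, one_pow, mul_one]
  congr 2
  ext j
  simp
  ring

/-- A product `a b² c⁴ h⁸` of small degrees lies in `P_5^-((3,4,3))`. -/
theorem mul_mem_PMinus {i j k l : ℕ} {a b c h : P5} (ha : a.IsHomogeneous i)
    (hb : b.IsHomogeneous j) (hc : c.IsHomogeneous k) (hh : h.IsHomogeneous l)
    (hdeg : i + 2 * j + 4 * k + 8 * l = 23)
    (hlt : i < 3 ∨ i = 3 ∧ j < 4 ∨ i = 3 ∧ j = 4 ∧ k < 3) :
    a * b ^ 2 * c ^ 4 * h ^ 8 ∈ PMinus 23 [3, 4, 3] := by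
  have p4 : ∀ x y : P5, (x + y) ^ 4 = x ^ 4 + y ^ 4 := fun x y => by
    rw [show (4 : ℕ) = 2 * 2 from rfl, pow_mul, pow_mul, pow_mul, add_sq_P5, add_sq_P5]
  have p8 : ∀ x y : P5, (x + y) ^ 8 = x ^ 8 + y ^ 8 := fun x y => by
    rw [show (8 : ℕ) = 4 * 2 from rfl, pow_mul, pow_mul, pow_mul, p4, add_sq_P5]
  refine map_mem_of_isHomogeneous (fun a => a * b ^ 2 * c ^ 4 * h ^ 8)
    (fun x y => by ring) _ (fun e0 h0 => ?_) ha
  refine map_mem_of_isHomogeneous (fun b => monomial e0 1 * b ^ 2 * c ^ 4 * h ^ 8)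
    (fun x y => by simp only [add_sq_P5]; ring) _ (fun e1 h1 => ?_) hb
  refine map_mem_of_isHomogeneous (fun c => monomial e0 1 * monomial e1 1 ^ 2 * c ^ 4 * h ^ 8)
    (fun x y => by simp only [p4]; ring) _ (fun e2 h2 => ?_) hc
  refine map_mem_of_isHomogeneous
    (fun h => monomial e0 1 * monomial e1 1 ^ 2 * monomial e2 1 ^ 4 * h ^ 8)
    (fun x y => by simp only [p8]; ring) _ (fun e3 h3 => ?_) hh
  refine Submodule.subset_span ⟨_, (monomial_eq_mul e0 e1 e2 e3).symm, ?_, ?_⟩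
  · rw [Finsupp.degree_eq_sum] at h0 h1 h2 h3
    simp only [Finsupp.add_apply, Finsupp.smul_apply, Finset.sum_add_distrib, smul_eq_mul,
      ← Finset.mul_sum, h0, h1, h2, h3]
    omega
  · exact wtLt_of_degree (by rwa [h0, h1, h2])

/-- The exponent vector whose entries are given by the `i`-th binary digits of those of `d`. -/
def bitVec (d : Fin 5 →₀ ℕ) (i : ℕ) : Fin 5 →₀ ℕ :=
  Finsupp.equivFunOnFinite.symm fun j => ((d j).testBit i).toNat

theorem degree_bitVec (d : Fin 5 →₀ ℕ) (i : ℕ) : (bitVec d i).degree = wt d i := by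
  rw [wt, Finset.card_filter, Finsupp.degree_eq_sum]
  refine Finset.sum_congr rfl fun j _ => ?_
  simp only [bitVec, Finsupp.equivFunOnFinite_symm_apply_apply]
  cases (d j).testBit i <;> rfl

theorem eq_bitVec_add (d : Fin 5 →₀ ℕ) :
    d = bitVec d 0 + 2 • (bitVec d 1 + 2 • (bitVec d 2 + 2 •
      Finsupp.equivFunOnFinite.symm fun j => d j / 8)) := by
  ext j
  simp only [bitVec, Finsupp.equivFunOnFinite_symm_apply_apply, Finsupp.add_apply,
    Finsupp.smul_apply, smul_eq_mul, Nat.toNat_testBit]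
  omega

theorem actGL_mem_PMinus (g : Matrix.GeneralLinearGroup (Fin 5) (ZMod 2)) {p : P5}
    (hp : p ∈ PMinus 23 [3, 4, 3]) : actGL g p ∈ PMinus 23 [3, 4, 3] := by
  suffices h : PMinus 23 [3, 4, 3] ≤ (PMinus 23 [3, 4, 3]).comap (actGL g).toLinearMap from h hp
  refine Submodule.span_le.mpr ?_
  rintro _ ⟨d, rfl, hd, hlt⟩
  change actGL g (monomial d 1) ∈ PMinus 23 [3, 4, 3]
  have e := eq_bitVec_add d
  rw [e, monomial_eq_mul]
  simp only [map_mul, map_pow]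
  have hm : ∀ e : Fin 5 →₀ ℕ, (actGL g (monomial e 1)).IsHomogeneous e.degree := fun e =>
    isHomogeneous_actGL g (isHomogeneous_monomial 1 rfl)
  refine mul_mem_PMinus (hm _) (hm _) (hm _) (hm _) ?_ ?_
  · rw [← hd]
    simp only [Finsupp.degree_eq_sum, Finset.mul_sum, ← Finset.sum_add_distrib]
    refine Finset.sum_congr rfl fun j _ => ?_
    have := DFunLike.congr_fun e j
    simp only [Finsupp.add_apply, Finsupp.smul_apply, smul_eq_mul] at this
    omega
  · simp only [degree_bitVec]
    obtain ⟨i, h1, h2⟩ := hlt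
    match i, h1, h2 with
    | 0, _, h2 => exact Or.inl (by simpa using h2)
    | 1, h1, h2 => exact Or.inr (Or.inl ⟨by simpa using h1 0, by simpa using h2⟩)
    | 2, h1, h2 =>
      exact Or.inr (Or.inr ⟨by simpa using h1 0, by simpa using h1 1, by simpa using h2⟩)
    | i + 3, _, h2 => simp at h2

theorem actGL_mem_hitMod (g : Matrix.GeneralLinearGroup (Fin 5) (ZMod 2)) {f : P5}
    (hf : f ∈ hitMod) : actGL g f ∈ hitMod := by
  obtain ⟨h, p, hh, hp, rfl⟩ := hf
  exact ⟨_, _, isHit_actGL g hh, actGL_mem_PMinus g hp, map_add _ _ _⟩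

/-- `Sq a = a + a₁ + a₂ + …` with `a`, `a₁`, `a₂` homogeneous of degrees `n`, `n + 1`, `n + 2`, the
remaining terms being of degree at least `n + 3`. -/
structure SqJet (n : ℕ) (a a₁ a₂ : P5) : Prop where
  hom : a.IsHomogeneous n
  hom₁ : a₁.IsHomogeneous (n + 1)
  hom₂ : a₂.IsHomogeneous (n + 2)
  rem : Sq a - (a + a₁ + a₂) ∈ idealOfVars (Fin 5) (ZMod 2) ^ (n + 3)

theorem mem_pow_idealOfVars {f : P5} {n : ℕ} (hf : f.IsHomogeneous n) :
    f ∈ idealOfVars (Fin 5) (ZMod 2) ^ n :=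
  (mem_pow_idealOfVars_iff' n f).mpr fun _ hx => hf.coeff_eq_zero hx.ne

theorem homogeneousComponent_eq_zero_of_mem_pow {f : P5} {n m : ℕ}
    (hf : f ∈ idealOfVars (Fin 5) (ZMod 2) ^ n) (hm : m < n) : homogeneousComponent m f = 0 := by
  ext d
  rw [coeff_homogeneousComponent, coeff_zero]
  split_ifs with h
  · exact (mem_pow_idealOfVars_iff' n f).mp hf d (by rw [h]; exact hm)
  · rfl

theorem sqJet_X (i : Fin 5) : SqJet 1 (X i) (X i ^ 2) 0 where
  hom := isHomogeneous_X _ i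
  hom₁ := isHomogeneous_X_pow i 2
  hom₂ := isHomogeneous_zero _ _ _
  rem := by simp [Sq_X]

theorem sqJet_one : SqJet 0 1 0 0 where
  hom := isHomogeneous_one _ _
  hom₁ := isHomogeneous_zero _ _ _
  hom₂ := isHomogeneous_zero _ _ _
  rem := by simp

theorem SqJet.mul {n m : ℕ} {a a₁ a₂ b b₁ b₂ : P5} (ha : SqJet n a a₁ a₂) (hb : SqJet m b b₁ b₂) :
    SqJet (n + m) (a * b) (a₁ * b + a * b₁) (a₂ * b + a₁ * b₁ + a * b₂) where
  hom := ha.hom.mul hb.hom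
  hom₁ := by
    refine IsHomogeneous.add ?_ ?_
    · convert ha.hom₁.mul hb.hom using 1; ring
    · convert ha.hom.mul hb.hom₁ using 1; ring
  hom₂ := by
    refine IsHomogeneous.add (IsHomogeneous.add ?_ ?_) ?_
    · convert ha.hom₂.mul hb.hom using 1; ring
    · convert ha.hom₁.mul hb.hom₁ using 1; ring
    · convert ha.hom.mul hb.hom₂ using 1; ring
  rem := by
    set I := idealOfVars (Fin 5) (ZMod 2) with hI
    have key : Sq (a * b) - (a * b + (a₁ * b + a * b₁) + (a₂ * b + a₁ * b₁ + a * b₂)) =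
        (Sq a - (a + a₁ + a₂)) * (Sq b - (b + b₁ + b₂)) +
        (Sq a - (a + a₁ + a₂)) * (b + b₁ + b₂) + (a + a₁ + a₂) * (Sq b - (b + b₁ + b₂)) +
        a₁ * b₂ + a₂ * b₁ + a₂ * b₂ := by
      rw [map_mul]; ring
    have mm : ∀ {f g : P5} {k l : ℕ}, f ∈ I ^ k → g ∈ I ^ l → n + m + 3 ≤ k + l →
        f * g ∈ I ^ (n + m + 3) := fun hf hg h =>
      Ideal.pow_le_pow_right h (pow_add I _ _ ▸ Ideal.mul_mem_mul hf hg)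
    have low : ∀ {k : ℕ} {c c₁ c₂ : P5}, SqJet k c c₁ c₂ → c + c₁ + c₂ ∈ I ^ k := fun h =>
      add_mem (add_mem (mem_pow_idealOfVars h.hom)
        (Ideal.pow_le_pow_right (by omega) (mem_pow_idealOfVars h.hom₁)))
        (Ideal.pow_le_pow_right (by omega) (mem_pow_idealOfVars h.hom₂))
    have p1 := mem_pow_idealOfVars ha.hom₁
    have p2 := mem_pow_idealOfVars ha.hom₂
    have q1 := mem_pow_idealOfVars hb.hom₁
    have q2 := mem_pow_idealOfVars hb.hom₂
    rw [key]
    exact add_mem (add_mem (add_mem (add_mem (add_mem (mm ha.rem hb.rem (by omega))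
      (mm ha.rem (low hb) (by omega))) (mm (low ha) hb.rem (by omega)))
      (mm p1 q2 (by omega))) (mm p2 q1 (by omega))) (mm p2 q2 (by omega))

theorem SqJet.sq {n : ℕ} {a a₁ a₂ : P5} (ha : SqJet n a a₁ a₂) :
    SqJet (n + n) (a ^ 2) 0 (a₁ ^ 2) := by
  have h := ha.mul ha
  have h2 : (2 : P5) = 0 := CharTwo.two_eq_zero
  convert h using 1
  · ring
  · linear_combination (-(a * a₁)) * h2
  · linear_combination (-(a * a₂)) * h2

theorem SqJet.isHit_one {a a₁ a₂ : P5} (h : SqJet 22 a a₁ a₂) : IsHit 23 a₁ := by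
  refine ⟨a, fun m hm => ?_, ?_⟩
  · rw [homogeneousComponent_of_mem h.hom, if_neg (by omega)]
  · have e := homogeneousComponent_eq_zero_of_mem_pow h.rem (m := 23) (by omega)
    simp only [map_sub, map_add, homogeneousComponent_of_mem h.hom,
      homogeneousComponent_of_mem h.hom₁, homogeneousComponent_of_mem h.hom₂] at e
    simpa using (sub_eq_zero.mp e).symm

theorem SqJet.isHit_two {a a₁ a₂ : P5} (h : SqJet 21 a a₁ a₂) : IsHit 23 a₂ := by
  refine ⟨a, fun m hm => ?_, ?_⟩
  · rw [homogeneousComponent_of_mem h.hom, if_neg (by omega)]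
  · have e := homogeneousComponent_eq_zero_of_mem_pow h.rem (m := 23) (by omega)
    simp only [map_sub, map_add, homogeneousComponent_of_mem h.hom,
      homogeneousComponent_of_mem h.hom₁, homogeneousComponent_of_mem h.hom₂] at e
    simpa using (sub_eq_zero.mp e).symm

/-- The class of `a b² c⁴` modulo `hitMod`. -/
def cls (a b c : P5) : P5 ⧸ hitMod := hitMod.mkQ (a * b ^ 2 * c ^ 4)

theorem cls_eq_zero {a b c : P5} (h : a * b ^ 2 * c ^ 4 ∈ hitMod) : cls a b c = 0 :=
  (Submodule.Quotient.mk_eq_zero _).mpr h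

theorem add_pow_four_P5 (x y : P5) : (x + y) ^ 4 = x ^ 4 + y ^ 4 := by
  rw [show (4 : ℕ) = 2 * 2 from rfl, pow_mul, pow_mul, pow_mul, add_sq_P5, add_sq_P5]

theorem cls_add_left (a a' b c : P5) : cls (a + a') b c = cls a b c + cls a' b c := by
  simp only [cls, ← map_add]; congr 1; ring

theorem cls_add_mid (a b b' c : P5) : cls a (b + b') c = cls a b c + cls a b' c := by
  simp only [cls, ← map_add, add_sq_P5]; congr 1; ring

theorem cls_add_right (a b c c' : P5) : cls a b (c + c') = cls a b c + cls a b c' := by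
  simp only [cls, ← map_add, add_pow_four_P5]; congr 1; ring

theorem cls_sq_left {x y b c : P5} {i j k : ℕ} (hx : x.IsHomogeneous i) (hy : y.IsHomogeneous 1)
    (hb : b.IsHomogeneous j) (hc : c.IsHomogeneous k) (h : i + j + 2 * k = 11) :
    cls (x ^ 2 * y) b c = 0 := by
  refine cls_eq_zero (mem_hitMod_of_mem_PMinus ?_)
  convert mul_mem_PMinus hy ((hx.mul hb).mul (hc.pow 2)) (isHomogeneous_one _ _)
    (isHomogeneous_one _ _) (by omega) (Or.inl (by omega)) using 1
  ring

theorem cls_sq_mid {a x y c : P5} (ha : a.IsHomogeneous 3) (hx : x.IsHomogeneous 1)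
    (hy : y.IsHomogeneous 2) (hc : c.IsHomogeneous 3) : cls a (x ^ 2 * y) c = 0 := by
  refine cls_eq_zero (mem_hitMod_of_mem_PMinus ?_)
  convert mul_mem_PMinus ha hy (hx.mul hc) (isHomogeneous_one _ _) (by omega)
    (Or.inr (Or.inl (by omega))) using 1
  ring

theorem cls_sq_right {a b x y : P5} (ha : a.IsHomogeneous 3) (hb : b.IsHomogeneous 4)
    (hx : x.IsHomogeneous 1) (hy : y.IsHomogeneous 1) : cls a b (x ^ 2 * y) = 0 := by
  refine cls_eq_zero (mem_hitMod_of_mem_PMinus ?_)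
  convert mul_mem_PMinus ha hb hy hx (by omega) (Or.inr (Or.inr (by omega))) using 1
  ring

/-- The squarefree monomial whose variables are given by the binary digits of `a`. -/
def mono (a : ℕ) : P5 := ∏ i : Fin 5, if a.testBit i then X i else 1

/-- The degree of `mono a`. -/
def pc (a : ℕ) : ℕ := ∑ i : Fin 5, if a.testBit i then 1 else 0

theorem isHomogeneous_mono (a : ℕ) : (mono a).IsHomogeneous (pc a) := by
  refine IsHomogeneous.prod _ _ _ fun i _ => ?_
  split_ifs
  · exact isHomogeneous_X _ i
  · exact isHomogeneous_one _ _

theorem mono_split {a : ℕ} (i : Fin 5) (h : a.testBit i) :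
    mono a = X i * mono (a ^^^ 2 ^ (i : ℕ)) := by
  rw [mono, mono, ← Finset.mul_prod_erase _ _ (Finset.mem_univ i),
    ← Finset.mul_prod_erase (a := i) _ _ (Finset.mem_univ i)]
  simp only [h, if_true, Nat.testBit_xor, Nat.testBit_two_pow_self, bne_self_eq_false,
    Bool.false_eq_true, if_false, one_mul]
  congr 1
  refine Finset.prod_congr rfl fun j hj => ?_
  have hne : (i : ℕ) ≠ j := fun e => (Finset.mem_erase.mp hj).1 (Fin.ext e.symm)
  rw [Nat.testBit_two_pow_of_ne hne, Bool.xor_false]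

theorem X_mul_mono {a : ℕ} (i : Fin 5) (h : a.testBit i = false) :
    X i * mono a = mono (a ^^^ 2 ^ (i : ℕ)) := by
  rw [mono_split (a := a ^^^ 2 ^ (i : ℕ)) i (by simp [Nat.testBit_xor, h]), Nat.xor_assoc,
    Nat.xor_self, Nat.xor_zero]

theorem sqJet_mono (a : ℕ) : ∃ a₂, SqJet (pc a) (mono a)
    ((∑ i : Fin 5, if a.testBit i then X i else 0) * mono a) a₂ := by
  unfold pc mono
  induction (Finset.univ : Finset (Fin 5)) using Finset.induction_on with
  | empty => exact ⟨0, by simpa using sqJet_one⟩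
  | insert i s hi ih =>
    obtain ⟨a₂, h⟩ := ih
    rw [Finset.sum_insert hi, Finset.sum_insert hi, Finset.prod_insert hi]
    split_ifs
    · exact ⟨_, by convert (sqJet_X i).mul h using 1; ring⟩
    · exact ⟨_, by convert sqJet_one.mul h using 1; ring⟩

theorem Q_add_self (x : P5 ⧸ hitMod) : x + x = 0 := by
  rw [← two_smul (ZMod 2) x, show (2 : ZMod 2) = 0 from rfl, zero_smul]

/-- The class of the product of `mono a`, `mono b ^ 2` and `mono c ^ 4`. -/
def mcls (a b c : ℕ) : P5 ⧸ hitMod := cls (mono a) (mono b) (mono c)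

/-- The pairs obtained from `(a, b)` by moving a digit of `a` which is not in `b` to `b`. -/
def rel (a b : ℕ) : List (ℕ × ℕ) :=
  ((List.finRange 5).filter fun k : Fin 5 => a.testBit (k : ℕ) && !b.testBit (k : ℕ)).map
    fun k : Fin 5 => (a ^^^ 2 ^ (k : ℕ), b ^^^ 2 ^ (k : ℕ))

theorem sum_map_rel {M : Type*} [AddCommMonoid M] (a b : ℕ) (F : ℕ × ℕ → M) :
    ((rel a b).map F).sum = ∑ k : Fin 5,
      if a.testBit k && !b.testBit k then F (a ^^^ 2 ^ (k : ℕ), b ^^^ 2 ^ (k : ℕ)) else 0 := by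
  rw [rel, List.map_map, ← List.sum_ofFn, List.ofFn_eq_map]
  induction List.finRange 5 with
  | nil => rfl
  | cons k l ih =>
    rw [List.filter_cons, List.map_cons, List.sum_cons, ← ih]
    split_ifs <;> simp

theorem pc_xor_two_pow : ∀ a < 32, ∀ k : Fin 5,
    pc (a ^^^ 2 ^ (k : ℕ)) = if a.testBit k then pc a - 1 else pc a + 1 := by
  decide +kernel

theorem isHomogeneous_mono_of_eq {a n : ℕ} (h : pc a = n) : (mono a).IsHomogeneous n :=
  h ▸ isHomogeneous_mono a

/-- The relation given by `Sq¹`. -/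
theorem sum_rel_left {a b c : ℕ} (ha : a < 32) (hb : b < 32) (pa : pc a = 4) (pb : pc b = 3)
    (pC : pc c = 3) : ((rel a b).map fun x => mcls x.1 x.2 c).sum = 0 := by
  obtain ⟨a₂, ja⟩ := sqJet_mono a
  obtain ⟨b₂, jb⟩ := sqJet_mono b
  obtain ⟨c₂, jc⟩ := sqJet_mono c
  have hit := (ja.mul jb.sq).mul jc.sq.sq
  rw [pa, pb, pC] at hit
  have h0 : hitMod.mkQ (∑ i : Fin 5,
      (if a.testBit i then X i else 0) * mono a * mono b ^ 2 * mono c ^ 4) = 0 := by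
    refine (Submodule.Quotient.mk_eq_zero _).mpr ?_
    convert mem_hitMod_of_isHit hit.isHit_one using 1
    simp only [Finset.sum_mul, mul_zero, add_zero]
    exact Finset.sum_congr rfl fun k _ => by ring
  rw [sum_map_rel]
  refine Eq.trans ?_ h0
  rw [map_sum]
  refine Finset.sum_congr rfl fun k _ => ?_
  by_cases hk : a.testBit k
  · have e1 : (if a.testBit k then X k else 0) * mono a * mono b ^ 2 * mono c ^ 4 =
        mono (a ^^^ 2 ^ (k : ℕ)) * (X k * mono b) ^ 2 * mono c ^ 4 := by
      rw [if_pos hk, mono_split k hk]; ring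
    rw [e1]
    by_cases hk' : b.testBit k
    · rw [if_neg (by simp [hk'])]
      have hA := isHomogeneous_mono_of_eq
        (show pc (a ^^^ 2 ^ (k : ℕ)) = 3 by rw [pc_xor_two_pow a ha, if_pos hk, pa])
      have hB := isHomogeneous_mono_of_eq
        (show pc (b ^^^ 2 ^ (k : ℕ)) = 2 by rw [pc_xor_two_pow b hb, if_pos hk', pb])
      have := cls_sq_mid hA (isHomogeneous_X _ k) hB (isHomogeneous_mono_of_eq pC)
      rw [mono_split k hk', ← mul_assoc, ← sq]
      exact this.symm
    · simp only [Bool.not_eq_true] at hk'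
      rw [if_pos (by simp [hk, hk']), X_mul_mono k hk']
      rfl
  · simp [hk]

/-- The standard pair of masks `(a, b)` with `a &&& b = D`. -/
def canon (D : ℕ) : ℕ × ℕ :=
  let k := if D.testBit 0 then if D.testBit 1 then 2 else 1 else 0
  (D ||| 2 ^ k, 31 ^^^ 2 ^ k)

/-- The class given by the standard pair of masks. -/
def ncls (D c : ℕ) : P5 ⧸ hitMod := mcls (canon D).1 (canon D).2 c

set_option synthInstance.maxSize 1000 in
theorem rel_eq_singleton : ∀ a < 32, ∀ b < 32, pc a = 3 → pc b = 4 → a ||| b ≠ 31 →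
    (rel b a).Perm [(a, b)] := by decide +kernel

set_option synthInstance.maxSize 1000 in
theorem rel_perm_canon : ∀ a < 32, ∀ b < 32, pc a = 3 → pc b = 4 → a ||| b = 31 →
    (a, b) = canon (a &&& b) ∨
      a ||| (canon (a &&& b)).1 < 32 ∧ b &&& (canon (a &&& b)).2 < 32 ∧
      pc (a ||| (canon (a &&& b)).1) = 4 ∧ pc (b &&& (canon (a &&& b)).2) = 3 ∧
      (rel (a ||| (canon (a &&& b)).1) (b &&& (canon (a &&& b)).2)).Perm
        [(a, b), canon (a &&& b)] := by
  decide +kernel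

theorem eq_of_add_eq_zero_Q {x y : P5 ⧸ hitMod} (h : x + y = 0) : x = y :=
  add_right_cancel (h.trans (Q_add_self y).symm)

theorem sum_map_eq_of_perm {l l' : List (ℕ × ℕ)} {F : ℕ × ℕ → P5 ⧸ hitMod} (h : l.Perm l')
    (h0 : (l.map F).sum = 0) : (l'.map F).sum = 0 :=
  (h.map F).sum_eq.symm.trans h0

theorem mcls_eq_zero {a b c : ℕ} (ha : a < 32) (hb : b < 32) (pa : pc a = 3) (pb : pc b = 4)
    (pC : pc c = 3) (h : a ||| b ≠ 31) : mcls a b c = 0 := by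
  have := sum_rel_left hb ha pb pa pC
  simpa using sum_map_eq_of_perm (rel_eq_singleton a ha b hb pa pb h) this

theorem mcls_eq_ncls {a b c : ℕ} (ha : a < 32) (hb : b < 32) (pa : pc a = 3) (pb : pc b = 4)
    (pC : pc c = 3) (h : a ||| b = 31) : mcls a b c = ncls (a &&& b) c := by
  rcases rel_perm_canon a ha b hb pa pb h with e | ⟨h1, h2, h3, h4, h5⟩
  · rw [ncls, ← e]
  · have := sum_map_eq_of_perm h5 (sum_rel_left h1 h2 h3 h4 pC)
    exact eq_of_add_eq_zero_Q (by simpa [ncls] using this)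

theorem exists_mono_eq {a : ℕ} (ha : a < 32) (pa : pc a = 3) :
    ∃ i j k : Fin 5, mono a = X i * (X j * X k) := by
  have h : ∀ a < 32, pc a = 3 → ∃ i j k : Fin 5, a.testBit i ∧
      (a ^^^ 2 ^ (i : ℕ)).testBit j ∧ (a ^^^ 2 ^ (i : ℕ) ^^^ 2 ^ (j : ℕ)).testBit k ∧
      a ^^^ 2 ^ (i : ℕ) ^^^ 2 ^ (j : ℕ) ^^^ 2 ^ (k : ℕ) = 0 := by decide +kernel
  obtain ⟨i, j, k, h1, h2, h3, h4⟩ := h a ha pa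
  exact ⟨i, j, k, by rw [mono_split i h1, mono_split j h2, mono_split k h3, h4]; simp [mono]⟩

/-- The relation given by `Sq²`. -/
theorem sum_rel_right {a c : ℕ} (ha : a < 32) (hc : c < 32) (pa : pc a = 3) (pC : pc c = 2) :
    ((rel a c).map fun x => ncls x.1 x.2).sum = 0 := by
  obtain ⟨i, j, k, e⟩ := exists_mono_eq ha pa
  obtain ⟨v₂, jv⟩ := sqJet_mono 31
  obtain ⟨c₂, jc⟩ := sqJet_mono c
  have hit := (((sqJet_X i).mul ((sqJet_X j).mul (sqJet_X k))).mul jv.sq).mul jc.sq.sq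
  rw [pC, show pc 31 = 5 by decide] at hit
  have hl : ∀ l m n : Fin 5, cls ((X l * X m) ^ 2 * X n) (mono 31) (mono c) = 0 := fun l m n =>
    cls_sq_left ((isHomogeneous_X _ l).mul (isHomogeneous_X _ m)) (isHomogeneous_X _ n)
      (isHomogeneous_mono_of_eq (n := 5) (by decide)) (isHomogeneous_mono_of_eq pC) (by norm_num)
  have h0 : hitMod.mkQ (∑ l : Fin 5, mono a * (X l * (X l * mono (31 ^^^ 2 ^ (l : ℕ)))) ^ 2 *
      mono c ^ 4) = 0 := by
    have h1 := (Submodule.Quotient.mk_eq_zero _).mpr (mem_hitMod_of_isHit hit.isHit_two)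
    have h31 : (∑ i : Fin 5, if Nat.testBit 31 i then (X i : P5) else 0) * mono 31 =
        ∑ l : Fin 5, X l * (X l * mono (31 ^^^ 2 ^ (l : ℕ))) := by
      rw [Finset.sum_mul]
      refine Finset.sum_congr rfl fun l _ => ?_
      have ht : Nat.testBit 31 l = true := by revert l; decide
      rw [if_pos ht, mono_split l ht]
    rw [h31, ← e, CharTwo.sum_sq] at h1
    have h2 := congrArg₂ (· + ·) (congrArg₂ (· + ·) (hl i j k) (hl i k j)) (hl j k i)
    simp only [add_zero] at h2
    refine Eq.trans ?_ (Eq.trans (congrArg₂ (· + ·) h1 h2) (add_zero _))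
    unfold cls
    simp only [← Submodule.mkQ_apply, ← map_add]
    rw [← Finset.sum_mul, ← Finset.mul_sum]
    generalize (∑ l : Fin 5, (X l * (X l * mono (31 ^^^ 2 ^ (l : ℕ)))) ^ 2 : P5) = S
    refine congrArg _ ?_
    linear_combination (-((X i * X j) ^ 2 * X k + (X i * X k) ^ 2 * X j + (X j * X k) ^ 2 * X i) *
      mono 31 ^ 2 * mono c ^ 4) * (CharTwo.two_eq_zero : (2 : P5) = 0)
  rw [sum_map_rel]
  refine Eq.trans ?_ h0
  rw [map_sum]
  refine Finset.sum_congr rfl fun l _ => ?_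
  have hb : 31 ^^^ 2 ^ (l : ℕ) < 32 ∧ pc (31 ^^^ 2 ^ (l : ℕ)) = 4 := by revert l; decide
  have e1 : mono a * (X l * (X l * mono (31 ^^^ 2 ^ (l : ℕ)))) ^ 2 * mono c ^ 4 =
      mono a * mono (31 ^^^ 2 ^ (l : ℕ)) ^ 2 * (X l * mono c) ^ 4 := by ring
  rw [e1]
  change _ = cls (mono a) (mono (31 ^^^ 2 ^ (l : ℕ))) (X l * mono c)
  by_cases hk : c.testBit l
  · rw [if_neg (by simp [hk]), mono_split l hk, ← mul_assoc, ← sq]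
    exact (cls_sq_right (isHomogeneous_mono_of_eq pa) (isHomogeneous_mono_of_eq hb.2)
      (isHomogeneous_X _ l) (isHomogeneous_mono_of_eq
        (by rw [pc_xor_two_pow c hc, if_pos hk, pC]))).symm
  · simp only [Bool.not_eq_true] at hk
    have hp : pc (c ^^^ 2 ^ (l : ℕ)) = 3 := by rw [pc_xor_two_pow c hc, hk, pC]; rfl
    have hand : ∀ a < 32, ∀ l : Fin 5, (a.testBit l = true ↔ a ||| (31 ^^^ 2 ^ (l : ℕ)) = 31) ∧
        (a.testBit l = true → a &&& (31 ^^^ 2 ^ (l : ℕ)) = a ^^^ 2 ^ (l : ℕ)) := by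
      decide +kernel
    rw [X_mul_mono l hk]
    change _ = mcls _ _ _
    by_cases hk' : a.testBit l
    · rw [if_pos (by simp [hk, hk']), mcls_eq_ncls ha hb.1 pa hb.2 hp ((hand a ha l).1.mp hk'),
        (hand a ha l).2 hk']
    · rw [if_neg (by simp [hk']),
        mcls_eq_zero ha hb.1 pa hb.2 hp (fun h => hk' ((hand a ha l).1.mpr h))]

/-- The bitwise sum of a list of natural numbers. -/
def xsum (l : List ℕ) : ℕ := l.foldr (· ^^^ ·) 0

/-- The positions of the digits encoding coordinate vectors. -/
def idx : List ℕ := List.range' 1 24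

/-- The pair `(D, c)` whose class is the basis vector with index `5 i + j`. -/
def rep (k : ℕ) : ℕ × ℕ :=
  if k / 5 = k % 5 then (1 ||| 2 ^ (k / 5), 31 ^^^ (1 ||| 2 ^ (k / 5)))
  else
    let x := if k / 5 ≠ 0 ∧ k % 5 ≠ 0 then 0 else if k / 5 ≠ 1 ∧ k % 5 ≠ 1 then 1 else 2
    (2 ^ (k / 5) ||| 2 ^ x, 31 ^^^ 2 ^ (k % 5) ^^^ 2 ^ x)

/-- The coordinate vector of `ncls D c`. -/
def nf2 (D c : ℕ) : ℕ :=
  if D &&& c = 0 then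
    xsum ([1, 2, 3, 4].map fun i => if D.testBit i then 2 ^ (6 * i) else 0)
  else if pc (D &&& c) = 1 then 2 ^ (5 * Nat.log2 (D &&& c) + Nat.log2 (31 ^^^ (D ||| c)))
  else 0

/-- The coordinate vector of `mcls a b c`. -/
def nf (a b c : ℕ) : ℕ := if a ||| b = 31 then nf2 (a &&& b) c else 0

/-- The substitution `x_q ↦ x_q + x_p` applied to a squarefree monomial, without the terms which
are not squarefree. -/
def sub (p q : Fin 5) (a : ℕ) : List ℕ :=
  if a.testBit q && !a.testBit p then [a, a ^^^ 2 ^ (q : ℕ) ^^^ 2 ^ (p : ℕ)] else [a]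

/-- The coordinate vector of the image of `mcls a b c` under `x_q ↦ x_q + x_p`. -/
def act (p q : Fin 5) (a b c : ℕ) : ℕ :=
  xsum ((sub p q a).map fun x => xsum ((sub p q b).map fun y =>
    xsum ((sub p q c).map fun z => nf x y z)))

/-- The action of `x_q ↦ x_q + x_p` on coordinate vectors. -/
def tau (v : ℕ) (s : Fin 5 × Fin 5) : ℕ :=
  xsum (idx.map fun k => if v.testBit k then
    act s.1 s.2 (canon (rep k).1).1 (canon (rep k).1).2 (rep k).2 else 0)

/-- The action of `1 + g + g² + g³ + g⁴` on coordinate vectors, for a product `g` of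
transvections. -/
def tauNorm (w : List (Fin 5 × Fin 5)) (v : ℕ) : ℕ :=
  let g := fun v => w.foldl tau v
  v ^^^ g (v ^^^ g (v ^^^ g (v ^^^ g v)))

/-- A first product of transvections, the leftmost factor acting first. -/
def word₁ : List (Fin 5 × Fin 5) := [(4, 2), (4, 3), (1, 2), (3, 1), (2, 4)]

/-- A second product of transvections, the leftmost factor acting first. -/
def word₂ : List (Fin 5 × Fin 5) := [(2, 1), (4, 0), (0, 2), (1, 4), (1, 2)]

theorem tauNorm_eq_zero : ∀ k ∈ idx, tauNorm word₁ (tauNorm word₂ (tauNorm word₁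
    (nf (canon (rep k).1).1 (canon (rep k).1).2 (rep k).2))) = 0 := by
  decide +kernel

/-- The representatives of the basis vectors occurring in a coordinate vector. -/
def reps (v : ℕ) : List (ℕ × ℕ) := (idx.filter v.testBit).map rep

set_option synthInstance.maxSize 1000 in
theorem reps_nf2 : ∀ D < 32, pc D = 2 → ∀ c < 32, pc c = 3 →
    (D, c) = (reps (nf2 D c)).headI ∧ (reps (nf2 D c)).length = 1 ∨
    ∃ p ∈ [(c, D), (D ||| (reps (nf2 D c)).headI.1, c &&& (reps (nf2 D c)).headI.2),
      (D ||| 1, 31 ^^^ (D ||| 1))], p.1 < 32 ∧ p.2 < 32 ∧ pc p.1 = 3 ∧ pc p.2 = 2 ∧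
        (rel p.1 p.2).Perm ((D, c) :: reps (nf2 D c)) := by
  decide +kernel

theorem rep_spec : ∀ k ∈ idx, (canon (rep k).1).1 < 32 ∧ (canon (rep k).1).2 < 32 ∧
    (rep k).2 < 32 ∧ pc (canon (rep k).1).1 = 3 ∧ pc (canon (rep k).1).2 = 4 ∧
    pc (rep k).2 = 3 := by
  decide +kernel

/-- The class with coordinate vector `v`. -/
def vcls (v : ℕ) : P5 ⧸ hitMod :=
  (idx.map fun k => if v.testBit k then ncls (rep k).1 (rep k).2 else 0).sum

theorem vcls_eq_sum_reps (v : ℕ) : vcls v = ((reps v).map fun x => ncls x.1 x.2).sum := by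
  rw [vcls, reps]
  induction idx with
  | nil => rfl
  | cons k l ih =>
    rw [List.filter_cons, List.map_cons, List.sum_cons, ih]
    split_ifs <;> simp

theorem vcls_xor (v w : ℕ) : vcls (v ^^^ w) = vcls v + vcls w := by
  unfold vcls
  rw [← List.sum_map_add]
  congr 2
  funext k
  rw [Nat.testBit_xor]
  cases v.testBit k <;> cases w.testBit k <;> simp [Q_add_self]

theorem vcls_zero : vcls 0 = 0 := by
  simpa [Q_add_self] using vcls_xor 0 0

theorem vcls_xsum (l : List ℕ) : vcls (xsum l) = (l.map vcls).sum := by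
  induction l with
  | nil => exact vcls_zero
  | cons a l ih => rw [List.map_cons, List.sum_cons, ← ih, ← vcls_xor]; rfl

theorem ncls_eq_vcls {D c : ℕ} (hD : D < 32) (pD : pc D = 2) (hc : c < 32) (pC : pc c = 3) :
    ncls D c = vcls (nf2 D c) := by
  rw [vcls_eq_sum_reps]
  rcases reps_nf2 D hD pD c hc pC with ⟨h1, h2⟩ | ⟨p, -, h1, h2, h3, h4, h5⟩
  · obtain ⟨x, hx⟩ := List.length_eq_one_iff.mp h2
    rw [hx] at h1 ⊢
    obtain rfl : (D, c) = x := h1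
    simp
  · have := sum_map_eq_of_perm h5 (sum_rel_right h1 h2 h3 h4)
    rw [List.map_cons, List.sum_cons] at this
    exact eq_of_add_eq_zero_Q this

set_option synthInstance.maxSize 1000 in
theorem mcls_eq_vcls {a b c : ℕ} (ha : a < 32) (hb : b < 32) (hc : c < 32) (pa : pc a = 3)
    (pb : pc b = 4) (pC : pc c = 3) : mcls a b c = vcls (nf a b c) := by
  unfold nf
  split_ifs with h
  · have hD : ∀ a < 32, ∀ b < 32, pc a = 3 → pc b = 4 → a ||| b = 31 →
        a &&& b < 32 ∧ pc (a &&& b) = 2 := by decide +kernel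
    obtain ⟨h1, h2⟩ := hD a ha b hb pa pb h
    rw [mcls_eq_ncls ha hb pa pb pC h, ncls_eq_vcls h1 h2 hc pC]
  · rw [mcls_eq_zero ha hb pa pb pC h, vcls_zero]

/-- The transvection `x_q ↦ x_q + x_p`. -/
def tv (s : Fin 5 × Fin 5) : Matrix.GeneralLinearGroup (Fin 5) (ZMod 2) :=
  if h : s.2 ≠ s.1 then Matrix.GeneralLinearGroup.mkOfDetNeZero (Matrix.transvection s.2 s.1 1)
    (by rw [Matrix.det_transvection_of_ne _ _ h]; exact one_ne_zero)
  else 1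

theorem actGL_tv_X {p q : Fin 5} (h : p ≠ q) (i : Fin 5) :
    actGL (tv (p, q)) (X i) = if i = q then X q + X p else X i := by
  have e : ((tv (p, q) : Matrix.GeneralLinearGroup (Fin 5) (ZMod 2)) :
      Matrix (Fin 5) (Fin 5) (ZMod 2)) = Matrix.transvection q p 1 := by
    rw [tv, dif_pos h.symm]; rfl
  rw [actGL_X, e]
  simp only [Matrix.transvection, Matrix.add_apply, Matrix.one_apply, Matrix.single_apply, add_smul,
    Finset.sum_add_distrib, ite_smul, one_smul, zero_smul, Finset.sum_ite_eq, Finset.mem_univ,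
    if_true]
  split_ifs with hi
  · subst hi; simp
  · simp [Ne.symm hi]

theorem actGL_tv_mono_of_not {p q : Fin 5} (h : p ≠ q) {a : ℕ} (ha : a.testBit q = false) :
    actGL (tv (p, q)) (mono a) = mono a := by
  unfold mono
  rw [map_prod]
  refine Finset.prod_congr rfl fun i _ => ?_
  split_ifs with hi
  · rw [actGL_tv_X h, if_neg]
    rintro rfl
    simp [ha] at hi
  · exact map_one _

theorem actGL_tv_mono {p q : Fin 5} (h : p ≠ q) {a : ℕ} (ha : a < 32) :
    ∃ y : P5, y.IsHomogeneous (pc a - 2) ∧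
      actGL (tv (p, q)) (mono a) = ((sub p q a).map mono).sum + X p ^ 2 * y := by
  by_cases hq : a.testBit q
  · have hq' : (a ^^^ 2 ^ (q : ℕ)).testBit q = false := by simp [Nat.testBit_xor, hq]
    have hp' : (a ^^^ 2 ^ (q : ℕ)).testBit p = a.testBit p := by
      rw [Nat.testBit_xor, Nat.testBit_two_pow_of_ne (fun e => h (Fin.ext e.symm)), Bool.xor_false]
    have e : actGL (tv (p, q)) (mono a) = mono a + X p * mono (a ^^^ 2 ^ (q : ℕ)) := by
      rw [mono_split q hq, map_mul, actGL_tv_mono_of_not h hq', actGL_tv_X h, if_pos rfl]; ring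
    by_cases hp : a.testBit p
    · refine ⟨mono (a ^^^ 2 ^ (q : ℕ) ^^^ 2 ^ (p : ℕ)), isHomogeneous_mono_of_eq ?_, ?_⟩
      · have hx : ∀ a < 32, ∀ q : Fin 5, a ^^^ 2 ^ (q : ℕ) < 32 := by decide +kernel
        rw [pc_xor_two_pow _ (hx a ha q), hp', if_pos hp, pc_xor_two_pow _ ha, if_pos hq]; rfl
      · rw [e, mono_split p (hp'.trans hp), sub, if_neg (by simp [hp])]
        simp only [List.map_cons, List.map_nil, List.sum_cons, List.sum_nil]
        ring
    · refine ⟨0, isHomogeneous_zero _ _ _, ?_⟩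
      simp only [Bool.not_eq_true] at hp
      rw [e, X_mul_mono p (hp'.trans hp), sub, if_pos (by simp [hp, hq])]
      simp
  · refine ⟨0, isHomogeneous_zero _ _ _, ?_⟩
    simp only [Bool.not_eq_true] at hq
    rw [actGL_tv_mono_of_not h hq, sub, if_neg (by simp [hq])]
    simp

theorem sub_spec : ∀ a < 32, ∀ p q : Fin 5, ∀ x ∈ sub p q a, x < 32 ∧ pc x = pc a := by
  decide +kernel

theorem isHomogeneous_sum_mono {n : ℕ} {l : List ℕ} (h : ∀ x ∈ l, pc x = n) :
    ((l.map mono).sum).IsHomogeneous n := by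
  induction l with
  | nil => exact isHomogeneous_zero _ _ _
  | cons a l ih =>
    rw [List.map_cons, List.sum_cons]
    exact (isHomogeneous_mono_of_eq (h a (by simp))).add (ih fun x hx => h x (by simp [hx]))

/-- The map induced by `g` modulo `hitMod`. -/
def actQ (g : Matrix.GeneralLinearGroup (Fin 5) (ZMod 2)) :
    (P5 ⧸ hitMod) →ₗ[ZMod 2] (P5 ⧸ hitMod) :=
  hitMod.mapQ hitMod (actGL g).toLinearMap fun _ hf => actGL_mem_hitMod g hf

theorem actQ_cls (g : Matrix.GeneralLinearGroup (Fin 5) (ZMod 2)) (a b c : P5) :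
    actQ g (cls a b c) = cls (actGL g a) (actGL g b) (actGL g c) := by
  have : actQ g (cls a b c) = hitMod.mkQ (actGL g (a * b ^ 2 * c ^ 4)) := rfl
  rw [this, cls, map_mul (actGL g), map_mul (actGL g), map_pow (actGL g), map_pow (actGL g)]

theorem cls_sum_left (l : List ℕ) (b c : P5) :
    cls (l.map mono).sum b c = (l.map fun x => cls (mono x) b c).sum := by
  induction l with
  | nil => simp [cls]
  | cons a l ih => simp only [List.map_cons, List.sum_cons, cls_add_left, ih]

theorem cls_sum_mid (a : P5) (l : List ℕ) (c : P5) :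
    cls a (l.map mono).sum c = (l.map fun x => cls a (mono x) c).sum := by
  induction l with
  | nil => simp [cls]
  | cons b l ih => simp only [List.map_cons, List.sum_cons, cls_add_mid, ih]

theorem cls_sum_right (a b : P5) (l : List ℕ) :
    cls a b (l.map mono).sum = (l.map fun x => cls a b (mono x)).sum := by
  induction l with
  | nil => simp [cls]
  | cons c l ih => simp only [List.map_cons, List.sum_cons, cls_add_right, ih]

theorem actQ_mcls {p q : Fin 5} (h : p ≠ q) {a b c : ℕ} (ha : a < 32) (hb : b < 32) (hc : c < 32)
    (pa : pc a = 3) (pb : pc b = 4) (pC : pc c = 3) :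
    actQ (tv (p, q)) (mcls a b c) = vcls (act p q a b c) := by
  obtain ⟨x, hx, ex⟩ := actGL_tv_mono h ha
  obtain ⟨y, hy, ey⟩ := actGL_tv_mono h hb
  obtain ⟨z, hz, ez⟩ := actGL_tv_mono h hc
  rw [pa] at hx
  rw [pb] at hy
  rw [pC] at hz
  have sa : (((sub p q a).map mono).sum).IsHomogeneous 3 :=
    isHomogeneous_sum_mono fun x hx => (sub_spec a ha p q x hx).2.trans pa
  have sb : (((sub p q b).map mono).sum).IsHomogeneous 4 :=
    isHomogeneous_sum_mono fun x hx => (sub_spec b hb p q x hx).2.trans pb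
  have hB := isHomogeneous_actGL (tv (p, q)) (isHomogeneous_mono_of_eq pb)
  have hC := isHomogeneous_actGL (tv (p, q)) (isHomogeneous_mono_of_eq pC)
  rw [mcls, actQ_cls, ex, cls_add_left, cls_sq_left (isHomogeneous_X _ p) hx hB hC (by norm_num),
    add_zero, ey, cls_add_mid, cls_sq_mid sa (isHomogeneous_X _ p) hy hC, add_zero, ez,
    cls_add_right, cls_sq_right sa sb (isHomogeneous_X _ p) hz, add_zero, cls_sum_left, act,
    vcls_xsum, List.map_map]
  refine congrArg List.sum (List.map_congr_left fun x hx => ?_)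
  rw [cls_sum_mid, Function.comp_apply, vcls_xsum, List.map_map]
  refine congrArg List.sum (List.map_congr_left fun y hy => ?_)
  rw [cls_sum_right, Function.comp_apply, vcls_xsum, List.map_map]
  refine congrArg List.sum (List.map_congr_left fun z hz => ?_)
  have h1 := sub_spec a ha p q x hx
  have h2 := sub_spec b hb p q y hy
  have h3 := sub_spec c hc p q z hz
  exact mcls_eq_vcls h1.1 h2.1 h3.1 (h1.2.trans pa) (h2.2.trans pb) (h3.2.trans pC)

theorem actQ_vcls {s : Fin 5 × Fin 5} (h : s.1 ≠ s.2) (v : ℕ) :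
    actQ (tv s) (vcls v) = vcls (tau v s) := by
  rw [tau, vcls_xsum, List.map_map, vcls, map_list_sum, List.map_map]
  refine congrArg List.sum (List.map_congr_left fun k hk => ?_)
  obtain ⟨h1, h2, h3, h4, h5, h6⟩ := rep_spec k hk
  simp only [Function.comp_apply]
  split_ifs
  · exact actQ_mcls h h1 h2 h3 h4 h5 h6
  · rw [map_zero, vcls_zero]

/-- The action of a product of transvections. -/
def actWord (w : List (Fin 5 × Fin 5)) (x : P5 ⧸ hitMod) : P5 ⧸ hitMod :=
  w.foldl (fun x s => actQ (tv s) x) x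

theorem actWord_add (w : List (Fin 5 × Fin 5)) (x y : P5 ⧸ hitMod) :
    actWord w (x + y) = actWord w x + actWord w y := by
  unfold actWord
  induction w generalizing x y with
  | nil => rfl
  | cons s w ih => simp only [List.foldl_cons, map_add, ih]

theorem actWord_vcls {w : List (Fin 5 × Fin 5)} (h : ∀ s ∈ w, s.1 ≠ s.2) (v : ℕ) :
    actWord w (vcls v) = vcls (w.foldl tau v) := by
  unfold actWord
  induction w generalizing v with
  | nil => rfl
  | cons s w ih =>
    rw [List.foldl_cons, List.foldl_cons, actQ_vcls (h s (by simp)),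
      ih fun t ht => h t (by simp [ht])]

theorem actWord_of_fixed {x : P5 ⧸ hitMod} (hx : ∀ g, actQ g x = x) (w : List (Fin 5 × Fin 5)) :
    actWord w x = x := by
  unfold actWord
  induction w with
  | nil => rfl
  | cons s w ih => rw [List.foldl_cons, hx, ih]

/-- The action of `1 + g + g² + g³ + g⁴` for a product `g` of transvections. -/
def actNorm (w : List (Fin 5 × Fin 5)) (x : P5 ⧸ hitMod) : P5 ⧸ hitMod :=
  x + actWord w (x + actWord w (x + actWord w (x + actWord w x)))

theorem actNorm_add (w : List (Fin 5 × Fin 5)) (x y : P5 ⧸ hitMod) :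
    actNorm w (x + y) = actNorm w x + actNorm w y := by
  simp only [actNorm, actWord_add]
  abel

theorem actNorm_vcls {w : List (Fin 5 × Fin 5)} (h : ∀ s ∈ w, s.1 ≠ s.2) (v : ℕ) :
    actNorm w (vcls v) = vcls (tauNorm w v) := by
  simp only [actNorm, tauNorm, actWord_vcls h, ← vcls_xor]

theorem actNorm_of_fixed {x : P5 ⧸ hitMod} (hx : ∀ g, actQ g x = x) (w : List (Fin 5 × Fin 5)) :
    actNorm w x = x := by
  have h0 : actWord w 0 = 0 := by simpa using actWord_add w 0 0
  simp only [actNorm, actWord_of_fixed hx, Q_add_self, h0, add_zero]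

/-- An element of the group algebra of augmentation one annihilating all classes. -/
def annih : (P5 ⧸ hitMod) →+ (P5 ⧸ hitMod) :=
  AddMonoidHom.mk' (fun x => actNorm word₁ (actNorm word₂ (actNorm word₁ x)))
    fun x y => by simp only [actNorm_add]

theorem annih_vcls (v : ℕ) : annih (vcls v) = 0 := by
  rw [vcls, map_list_sum, List.map_map]
  refine List.sum_eq_zero fun y hy => ?_
  obtain ⟨k, hk, rfl⟩ := List.mem_map.mp hy
  simp only [Function.comp_apply]
  split_ifs
  · obtain ⟨h1, h2, h3, h4, h5, h6⟩ := rep_spec k hk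
    have w1 : ∀ s ∈ word₁, s.1 ≠ s.2 := by decide
    have w2 : ∀ s ∈ word₂, s.1 ≠ s.2 := by decide
    rw [ncls, mcls_eq_vcls h1 h2 h3 h4 h5 h6]
    change actNorm word₁ (actNorm word₂ (actNorm word₁ _)) = 0
    rw [actNorm_vcls w1, actNorm_vcls w2, actNorm_vcls w1, tauNorm_eq_zero k hk, vcls_zero]
  · exact map_zero _

theorem exists_mono_eq_monomial (d : Fin 5 →₀ ℕ) (i : ℕ) :
    ∃ a < 32, pc a = wt d i ∧ (monomial (bitVec d i) 1 : P5) = mono a := by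
  have h : ∀ t : Fin 5 → Bool, ∃ a < 32, ∀ j : Fin 5, a.testBit j = t j := by decide +kernel
  obtain ⟨a, ha, hd⟩ := h fun j => (d j).testBit i
  refine ⟨a, ha, ?_, ?_⟩
  · simp only [pc, hd, wt, Finset.card_filter]
  · rw [monomial_eq, map_one, one_mul, Finsupp.prod_fintype _ _ fun _ => pow_zero _]
    refine Finset.prod_congr rfl fun j _ => ?_
    rw [hd j]
    simp only [bitVec, Finsupp.equivFunOnFinite_symm_apply_apply]
    cases (d j).testBit i <;> simp

theorem mkQ_monomial_eq_mcls {d : Fin 5 →₀ ℕ} (hw : hasWt d [3, 4, 3]) (hd : ∑ j, d j = 23) :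
    ∃ a < 32, ∃ b < 32, ∃ c < 32, pc a = 3 ∧ pc b = 4 ∧ pc c = 3 ∧
      hitMod.mkQ (monomial d 1) = mcls a b c := by
  obtain ⟨a, ha, pa, ea⟩ := exists_mono_eq_monomial d 0
  obtain ⟨b, hb, pb, eb⟩ := exists_mono_eq_monomial d 1
  obtain ⟨c, hc, pC, ec⟩ := exists_mono_eq_monomial d 2
  refine ⟨a, ha, b, hb, c, hc, pa.trans (hw 0), pb.trans (hw 1), pC.trans (hw 2), ?_⟩
  have e := eq_bitVec_add d
  have e3 : Finsupp.equivFunOnFinite.symm (fun j => d j / 8) = 0 := by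
    have hs : ∑ j, d j / 8 = 0 := by
      have h0 := (degree_bitVec d 0).trans (hw 0)
      have h1 := (degree_bitVec d 1).trans (hw 1)
      have h2 := (degree_bitVec d 2).trans (hw 2)
      rw [Finsupp.degree_eq_sum] at h0 h1 h2
      have hj : ∑ j, d j = ∑ j, bitVec d 0 j + 2 * ∑ j, bitVec d 1 j + 4 * ∑ j, bitVec d 2 j +
          8 * ∑ j, d j / 8 := by
        simp only [Finset.mul_sum, ← Finset.sum_add_distrib]
        refine Finset.sum_congr rfl fun j _ => ?_
        have := DFunLike.congr_fun e j
        simp only [Finsupp.add_apply, Finsupp.smul_apply, smul_eq_mul,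
          Finsupp.equivFunOnFinite_symm_apply_apply] at this
        omega
      rw [hd, h0, h1, h2] at hj
      simp only [List.getD_cons_zero, List.getD_cons_succ] at hj
      omega
    ext j
    exact Finset.sum_eq_zero_iff.mp hs j (Finset.mem_univ j)
  rw [e, monomial_eq_mul, e3, ea, eb, ec]
  simp [mcls, cls]

theorem annih_mkQ {f : P5} (hf : f ∈ PLe 23 [3, 4, 3]) : annih (hitMod.mkQ f) = 0 := by
  induction hf using Submodule.span_induction with
  | mem x hx =>
    obtain ⟨d, rfl, hd, hw | hw⟩ := hx
    · rw [show hitMod.mkQ (monomial d 1) = 0 from (Submodule.Quotient.mk_eq_zero _).mpr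
        (mem_hitMod_of_mem_PMinus (Submodule.subset_span ⟨d, rfl, hd, hw⟩)), map_zero]
    · obtain ⟨a, ha, b, hb, c, hc, pa, pb, pC, e⟩ := mkQ_monomial_eq_mcls hw hd
      rw [e, mcls_eq_vcls ha hb hc pa pb pC, annih_vcls]
  | zero => simp only [map_zero]
  | add x y _ _ hx hy => rw [map_add, map_add, hx, hy, add_zero]
  | smul t x _ hx =>
    have ht : ∀ t : ZMod 2, t = 0 ∨ t = 1 := by decide
    rcases ht t with rfl | rfl
    · rw [zero_smul, map_zero, map_zero]
    · rw [one_smul, hx]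

/-- The GL_5-invariants of QP_5((3, 4, 3)) in degree 23 vanish. -/
theorem stmt15 (f : P5) (hf : f ∈ PLe 23 [3, 4, 3])
    (hinv : ∀ g : Matrix.GeneralLinearGroup (Fin 5) (ZMod 2),
      ∃ h p : P5, IsHit 23 h ∧ p ∈ PMinus 23 [3, 4, 3] ∧ actGL g f - f = h + p) :
    ∃ h p : P5, IsHit 23 h ∧ p ∈ PMinus 23 [3, 4, 3] ∧ f = h + p := by
  have hx : ∀ g, actQ g (hitMod.mkQ f) = hitMod.mkQ f := fun g =>
    (Submodule.Quotient.eq hitMod).mpr (hinv g)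
  have h0 : actNorm word₁ (actNorm word₂ (actNorm word₁ (hitMod.mkQ f))) = 0 := annih_mkQ hf
  rw [actNorm_of_fixed hx, actNorm_of_fixed hx, actNorm_of_fixed hx] at h0
  exact (Submodule.Quotient.mk_eq_zero _).mp h0
end
end

section
/- The GL_5-invariants of QP_5((3,4,1,1)) vanish: if f is an F_2-linear combination of monomials of degree 23 whose weight vectors are ≤ (3,4,1,1,0,...) in left lexicographic order, and for every g in GL_5(F_2) the polynomial g·f − f is the sum of a hit polynomial and an element of P_5^−((3,4,1,1)), then f itself is the sum of a hit polynomial and an element of P_5^−((3,4,1,1)). -/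
open MvPolynomial

noncomputable section

/-- `wt` for an exponent vector given as a function. -/
def wtFun (d : Fin 5 → ℕ) (i : ℕ) : ℕ :=
  (Finset.univ.filter fun j : Fin 5 => Nat.testBit (d j) i).card

/-- Recursive comparison of the weight vector of `d` with a list: strictly smaller, or equal and
`B` holds. -/
def wtRel (B : Prop) : List ℕ → (Fin 5 → ℕ) → Prop
  | [], d => B ∧ d = 0
  | s :: w, d => wtFun d 0 < s ∨ (wtFun d 0 = s ∧ wtRel B w fun j => d j / 2)

theorem wtFun_succ (d : Fin 5 → ℕ) (i : ℕ) : wtFun d (i + 1) = wtFun (fun j => d j / 2) i := by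
  simp [wtFun, Nat.testBit_succ]

theorem wtFun_zero (d : Fin 5 → ℕ) : wtFun d 0 = ∑ j, d j % 2 := by
  simp only [wtFun, Finset.card_filter, Nat.testBit_zero]
  refine Finset.sum_congr rfl fun j _ => ?_
  rcases Nat.mod_two_eq_zero_or_one (d j) with h | h <;> simp [h]

theorem wtRel_iff (B : Prop) (w : List ℕ) (d : Fin 5 → ℕ) :
    wtRel B w d ↔ (∃ i, (∀ j, j < i → wtFun d j = w.getD j 0) ∧ wtFun d i < w.getD i 0) ∨
      (B ∧ ∀ i, wtFun d i = w.getD i 0) := by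
  induction w generalizing d with
  | nil =>
    simp only [wtRel, List.getD_nil, Nat.not_lt_zero, and_false, exists_false, false_or]
    refine and_congr_right fun _ => ⟨fun h i => by simp [h, wtFun], fun h => ?_⟩
    funext j
    refine Nat.eq_of_testBit_eq fun i => ?_
    have := h i
    simp only [wtFun, Finset.card_eq_zero, Finset.filter_eq_empty_iff] at this
    simpa using this (Finset.mem_univ j)
  | cons s w ih =>
    simp only [wtRel, ih]
    constructor
    · rintro (h | ⟨h, ⟨i, h1, h2⟩ | ⟨hB, h1⟩⟩)
      · exact Or.inl ⟨0, by simp, by simpa using h⟩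
      · refine Or.inl ⟨i + 1, fun j hj => ?_, by simpa [wtFun_succ] using h2⟩
        rcases j with _ | j
        · simpa using h
        · simpa [wtFun_succ] using h1 j (by omega)
      · refine Or.inr ⟨hB, fun j => ?_⟩
        rcases j with _ | j
        · simpa using h
        · simpa [wtFun_succ] using h1 j
    · rintro (⟨i, h1, h2⟩ | ⟨hB, h1⟩)
      · rcases i with _ | i
        · exact Or.inl (by simpa using h2)
        · refine Or.inr ⟨by simpa using h1 0 (by omega), Or.inl ⟨i, fun j hj => ?_, ?_⟩⟩
          · simpa [wtFun_succ] using h1 (j + 1) (by omega)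
          · simpa [wtFun_succ] using h2
      · refine Or.inr ⟨by simpa using h1 0, Or.inr ⟨hB, fun j => ?_⟩⟩
        simpa [wtFun_succ] using h1 (j + 1)

section Substitution

variable {K A : Type*} [CommRing K] [CommRing A] [Algebra K A]

/-- The monomial with exponent vector `a` in the elements `u i`. -/
def monProd (u : Fin 5 → A) (a : Fin 5 → ℕ) : A := ∏ i, u i ^ a i

theorem monProd_mul (u : Fin 5 → A) (a b : Fin 5 → ℕ) :
    monProd u a * monProd u b = monProd u (a + b) := by
  simp [monProd, Finset.prod_mul_distrib, pow_add]

theorem monProd_sq (u : Fin 5 → A) (a : Fin 5 → ℕ) :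
    monProd u a ^ 2 = monProd u fun i => 2 * a i := by
  simp [monProd, ← Finset.prod_pow, ← pow_mul, mul_comm]

/-- The span of the monomials in `u` whose exponent vector satisfies `S`. -/
def monSpan (K : Type*) [CommRing K] [Algebra K A] (u : Fin 5 → A) (S : (Fin 5 → ℕ) → Prop) :
    Submodule K A :=
  Submodule.span K {x | ∃ a, S a ∧ x = monProd u a}

theorem monProd_mem_monSpan (u : Fin 5 → A) {S : (Fin 5 → ℕ) → Prop} {a : Fin 5 → ℕ} (h : S a) :
    monProd u a ∈ monSpan K u S :=
  Submodule.subset_span ⟨a, h, rfl⟩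

theorem mul_mem_monSpan (u : Fin 5 → A) {S T U : (Fin 5 → ℕ) → Prop}
    (h : ∀ a b, S a → T b → U (a + b)) {x y : A} (hx : x ∈ monSpan K u S)
    (hy : y ∈ monSpan K u T) : x * y ∈ monSpan K u U := by
  have := Submodule.mul_mem_mul hx hy
  rw [monSpan, monSpan, Submodule.span_mul_span] at this
  refine Submodule.span_le.2 ?_ this
  rintro _ ⟨_, ⟨a, ha, rfl⟩, _, ⟨b, hb, rfl⟩, rfl⟩
  exact Submodule.subset_span ⟨a + b, h a b ha hb, monProd_mul u a b⟩

theorem sq_mem_monSpan [CharP A 2] (u : Fin 5 → A) {S : (Fin 5 → ℕ) → Prop}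
    {x : A} (hx : x ∈ monSpan K u S) :
    x ^ 2 ∈ monSpan K u fun b => ∃ a, S a ∧ b = fun i => 2 * a i := by
  induction hx using Submodule.span_induction with
  | mem x hx =>
    obtain ⟨a, ha, rfl⟩ := hx
    rw [monProd_sq]
    exact monProd_mem_monSpan u ⟨a, ha, rfl⟩
  | zero => simp
  | add x y _ _ hx hy =>
    rw [CharTwo.add_sq]
    exact Submodule.add_mem _ hx hy
  | smul c x _ hx =>
    rw [smul_pow]
    exact Submodule.smul_mem _ _ hx

theorem pow_mem_monSpan (u : Fin 5 → A) {x : A} (hx : x ∈ monSpan K u fun a => ∑ i, a i = 1)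
    (n : ℕ) : x ^ n ∈ monSpan K u fun a => ∑ i, a i = n := by
  induction n with
  | zero =>
    have := monProd_mem_monSpan (K := K) u (S := fun a => ∑ i, a i = 0) (a := 0) (by simp)
    simpa [monProd] using this
  | succ n ih =>
    rw [pow_succ]
    refine mul_mem_monSpan u (fun a b ha hb => ?_) ih hx
    simp [Finset.sum_add_distrib, ha, hb]

theorem monProd_mem_monSpan_degree (u l : Fin 5 → A)
    (hl : ∀ j, l j ∈ monSpan K u fun a => ∑ i, a i = 1) (d : Fin 5 → ℕ) :
    monProd l d ∈ monSpan K u fun a => ∑ i, a i = ∑ i, d i := by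
  have key (s : Finset (Fin 5)) :
      ∏ i ∈ s, l i ^ d i ∈ monSpan K u fun a => ∑ i, a i = ∑ i ∈ s, d i := by
    induction s using Finset.induction_on with
    | empty =>
      have := monProd_mem_monSpan (K := K) u (S := fun a => ∑ i, a i = 0) (a := 0) (by simp)
      simpa [monProd] using this
    | insert j s hj ih =>
      rw [Finset.prod_insert hj, Finset.sum_insert hj]
      refine mul_mem_monSpan u (fun a b ha hb => ?_) (pow_mem_monSpan u (hl j) (d j)) ih
      simp [Finset.sum_add_distrib, ha, hb]
  exact key Finset.univ

theorem monProd_eq_mul_sq (l : Fin 5 → A) (d : Fin 5 → ℕ) :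
    monProd l d = monProd l (fun i => d i % 2) * monProd l (fun i => d i / 2) ^ 2 := by
  rw [monProd_sq, monProd_mul]
  congr 1
  funext i
  exact (Nat.mod_add_div _ _).symm

/-- Linear substitutions do not raise the weight vector. -/
theorem monProd_mem_monSpan_wtRel [CharP A 2] (u l : Fin 5 → A)
    (hl : ∀ j, l j ∈ monSpan K u fun a => ∑ i, a i = 1) (B : Prop) (w : List ℕ) (d : Fin 5 → ℕ)
    (hd : wtRel B w d) :
    monProd l d ∈ monSpan K u fun a => ∑ i, a i = ∑ i, d i ∧ wtRel B w a := by
  induction w generalizing d with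
  | nil =>
    obtain ⟨hB, rfl⟩ := hd
    have := monProd_mem_monSpan (K := K) u
      (S := fun a => ∑ i, a i = ∑ i, (0 : Fin 5 → ℕ) i ∧ wtRel B [] a) (a := 0)
      ⟨rfl, hB, rfl⟩
    simpa [monProd] using this
  | cons s w ih =>
    have hsum : ∑ i, d i = ∑ i, d i % 2 + 2 * ∑ i, d i / 2 := by
      rw [Finset.mul_sum, ← Finset.sum_add_distrib]
      exact Finset.sum_congr rfl fun i _ => (Nat.mod_add_div _ _).symm
    have hwt (a b : Fin 5 → ℕ) : wtFun (a + fun i => 2 * b i) 0 ≤ ∑ i, a i := by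
      rw [wtFun_zero]
      exact Finset.sum_le_sum fun i _ => by simp only [Pi.add_apply]; omega
    have hodd := monProd_mem_monSpan_degree u l hl fun i => d i % 2
    rw [monProd_eq_mul_sq]
    rcases hd with hd | ⟨hd, hd'⟩
    · refine mul_mem_monSpan u ?_ hodd
        (sq_mem_monSpan u (monProd_mem_monSpan_degree u l hl fun i => d i / 2))
      rintro a _ ha ⟨b, hb, rfl⟩
      refine ⟨by simp [Finset.sum_add_distrib, ← Finset.mul_sum, ha, hb, hsum], Or.inl ?_⟩
      rw [wtFun_zero] at hd
      exact lt_of_le_of_lt (hwt a b) (ha ▸ hd)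
    · refine mul_mem_monSpan u ?_ hodd (sq_mem_monSpan u (ih _ hd'))
      rintro a _ ha ⟨b, ⟨hb, hb'⟩, rfl⟩
      refine ⟨by simp [Finset.sum_add_distrib, ← Finset.mul_sum, ha, hb, hsum], ?_⟩
      rw [wtFun_zero] at hd
      rcases (hwt a b).lt_or_eq with h | h
      · exact Or.inl (by omega)
      · refine Or.inr ⟨by omega, ?_⟩
        have hle : ∀ i ∈ Finset.univ, (a + fun i => 2 * b i) i % 2 ≤ a i := fun i _ => by
          simp only [Pi.add_apply]; omega
        rw [wtFun_zero] at h
        have heq := (Finset.sum_eq_sum_iff_of_le hle).1 h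
        have : (fun j => (a + fun i => 2 * b i) j / 2) = b := by
          funext j
          have := heq j (Finset.mem_univ j)
          simp only [Pi.add_apply] at this ⊢
          omega
        rwa [this]

end Substitution

/-- The exponent vector obtained by trading one factor `y_s` for a factor `y_{s-1}^2`. -/
def trade (b : Fin 5 → ℕ) (s : Fin 5) : Fin 5 → ℕ :=
  fun i => b i - (if i = s then 1 else 0) + (if i = s - 1 then 2 else 0)

/-- The exponent vector obtained by trading a factor `y_{s-1}^2` for one factor `y_s`. -/
def untrade (a : Fin 5 → ℕ) (s : Fin 5) : Fin 5 → ℕ :=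
  fun i => a i - (if i = s - 1 then 2 else 0) + (if i = s then 1 else 0)

/-- `a` is obtained from `b` by trading at `q`, and all other trades lower the weight vector. -/
def IsLeadingTrade (a b : Fin 5 → ℕ) (q : Fin 5) : Prop :=
  ∑ i, b i = 22 ∧ trade b q = a ∧ b q % 2 = 1 ∧
    ∀ s, s = q ∨ b s % 2 = 0 ∨ (∑ i, trade b s i = 23 ∧ wtFun (trade b s) 0 = 3 ∧
      wtFun (trade b s) 1 < 4)

instance (a b : Fin 5 → ℕ) (q : Fin 5) : Decidable (IsLeadingTrade a b q) := by
  unfold IsLeadingTrade; infer_instance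

/-- The exponent vectors with residue `0` modulo `31` and weight vector `(3, 4, 1, 1)` are leading
trades. -/
def tradeCheck (a : Fin 5 → ℕ) : Bool :=
  !decide (wtFun a 0 = 3 ∧ wtFun a 1 = 4 ∧ wtFun a 2 = 1) ||
    decide (∃ q, IsLeadingTrade a (untrade a q) q)

theorem tradeCheck_all :
    ((List.range 24).all fun a => (List.range (24 - a)).all fun b =>
      (List.range (24 - a - b)).all fun c => (List.range (24 - a - b - c)).all fun d =>
        !Nat.beq ((a + 2 * b + 4 * c + 8 * d + 16 * (23 - a - b - c - d)) % 31) 0 ||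
          tradeCheck ![a, b, c, d, 23 - a - b - c - d]) = true := by
  decide +kernel

theorem exists_isLeadingTrade (a : Fin 5 → ℕ) (hsum : ∑ i, a i = 23)
    (hres : 31 ∣ ∑ i : Fin 5, 2 ^ (i : ℕ) * a i) (h0 : wtFun a 0 = 3) (h1 : wtFun a 1 = 4)
    (h2 : wtFun a 2 = 1) :
    ∃ b q, IsLeadingTrade a b q := by
  have key := tradeCheck_all
  simp only [List.all_eq_true, List.mem_range, Bool.or_eq_true] at key
  rw [Fin.sum_univ_five] at hsum hres
  have ha : ![a 0, a 1, a 2, a 3, 23 - a 0 - a 1 - a 2 - a 3] = a := by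
    funext i
    fin_cases i <;> simp
    omega
  have := key (a 0) (by omega) (a 1) (by omega) (a 2) (by omega) (a 3) (by omega)
  rw [ha, tradeCheck, Bool.or_eq_true] at this
  rcases this with h | h | h
  · have := Nat.ne_of_beq_eq_false (by simpa only [Bool.not_eq_true'] using h)
    simp at hres
    omega
  · simp [h0, h1, h2] at h
  · obtain ⟨q, hq⟩ := of_decide_eq_true h
    exact ⟨_, q, hq⟩

/-- The derivation `Sq^1`, with `Sq^1 (x_i) = x_i ^ 2`. -/
def sqOne (R : Type*) [CommRing R] :
    Derivation R (MvPolynomial (Fin 5) R) (MvPolynomial (Fin 5) R) :=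
  mkDerivation R fun i => X i ^ 2

theorem sqOne_X (R : Type*) [CommRing R] (i : Fin 5) : sqOne R (X i) = X i ^ 2 :=
  mkDerivation_X _ _ _

/-- `p` is homogeneous of degree `n` and `Sq p = p + Sq^1 p` up to terms of degree at least
`n + 2`. -/
def SqExpansion (n : ℕ) (p : P5) : Prop :=
  p.IsHomogeneous n ∧ (sqOne (ZMod 2) p).IsHomogeneous (n + 1) ∧
    Sq p - p - sqOne (ZMod 2) p ∈ idealOfVars (Fin 5) (ZMod 2) ^ (n + 2)

theorem mem_pow_idealOfVars_of_isHomogeneous {p : P5} {n : ℕ} (hp : p.IsHomogeneous n) :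
    p ∈ idealOfVars (Fin 5) (ZMod 2) ^ n := by
  rw [mem_pow_idealOfVars_iff']
  exact fun x hx => hp.coeff_eq_zero hx.ne

theorem SqExpansion.mul {m n : ℕ} {p q : P5} (hp : SqExpansion m p) (hq : SqExpansion n q) :
    SqExpansion (m + n) (p * q) := by
  obtain ⟨hp1, hp2, hp3⟩ := hp
  obtain ⟨hq1, hq2, hq3⟩ := hq
  refine ⟨hp1.mul hq1, ?_, ?_⟩
  · rw [Derivation.leibniz, smul_eq_mul, smul_eq_mul]
    refine IsHomogeneous.add (by simpa [add_assoc] using hp1.mul hq2) ?_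
    have := hq1.mul hp2
    rwa [show n + (m + 1) = m + n + 1 by ring] at this
  · have hq4 : Sq q - q ∈ idealOfVars (Fin 5) (ZMod 2) ^ (n + 1) := by
      have := add_mem (Ideal.pow_le_pow_right (by omega : n + 1 ≤ n + 2) hq3)
        (mem_pow_idealOfVars_of_isHomogeneous hq2)
      simpa using this
    have hq5 : Sq q ∈ idealOfVars (Fin 5) (ZMod 2) ^ n := by
      have := add_mem (Ideal.pow_le_pow_right (by omega : n ≤ n + 1) hq4)
        (mem_pow_idealOfVars_of_isHomogeneous hq1)
      simpa using this
    have h : Sq (p * q) - p * q - sqOne (ZMod 2) (p * q) =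
        (Sq p - p - sqOne (ZMod 2) p) * Sq q + p * (Sq q - q - sqOne (ZMod 2) q) +
          sqOne (ZMod 2) p * (Sq q - q) := by
      rw [Derivation.leibniz, smul_eq_mul, smul_eq_mul, map_mul]
      ring
    rw [h]
    refine add_mem (add_mem ?_ ?_) ?_
    · have := Ideal.mul_mem_mul hp3 hq5
      rwa [← pow_add, show m + 2 + n = m + n + 2 by ring] at this
    · have := Ideal.mul_mem_mul (mem_pow_idealOfVars_of_isHomogeneous hp1) hq3
      rwa [← pow_add, ← add_assoc] at this
    · have := Ideal.mul_mem_mul (mem_pow_idealOfVars_of_isHomogeneous hp2) hq4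
      rwa [← pow_add, show m + 1 + (n + 1) = m + n + 2 by ring] at this

theorem SqExpansion.one : SqExpansion 0 1 := by
  refine ⟨isHomogeneous_one _ _, ?_, ?_⟩
  · rw [Derivation.map_one_eq_zero]
    exact isHomogeneous_zero _ _ _
  · rw [Derivation.map_one_eq_zero, map_one]
    simp

theorem SqExpansion.X (i : Fin 5) : SqExpansion 1 (X i) := by
  refine ⟨isHomogeneous_X _ _, ?_, ?_⟩
  · rw [sqOne_X]
    simpa using (isHomogeneous_X (ZMod 2) i).pow 2
  · rw [sqOne_X]
    simp [Sq]

theorem SqExpansion.pow {n : ℕ} {p : P5} (hp : SqExpansion n p) (k : ℕ) :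
    SqExpansion (n * k) (p ^ k) := by
  induction k with
  | zero => simpa using SqExpansion.one
  | succ k ih =>
    rw [pow_succ, mul_add, mul_one]
    exact ih.mul hp

theorem SqExpansion.monProd (d : Fin 5 → ℕ) :
    SqExpansion (∑ i, d i) (monProd (fun i => (MvPolynomial.X i : P5)) d) := by
  have key (s : Finset (Fin 5)) :
      SqExpansion (∑ i ∈ s, d i) (∏ i ∈ s, (MvPolynomial.X i : P5) ^ d i) := by
    induction s using Finset.induction_on with
    | empty => simpa using SqExpansion.one
    | insert j s hj ih =>
      rw [Finset.prod_insert hj, Finset.sum_insert hj]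
      refine SqExpansion.mul ?_ ih
      simpa using (SqExpansion.X j).pow (d j)
  exact key Finset.univ

/-- `Sq^1` of a monomial of degree `n` is hit. -/
theorem isHit_sqOne_monProd (d : Fin 5 → ℕ) {n : ℕ} (hn : ∑ i, d i = n) :
    IsHit (n + 1) (sqOne (ZMod 2) (monProd (fun i => (X i : P5)) d)) := by
  obtain ⟨h1, h2, h3⟩ := hn ▸ SqExpansion.monProd d
  set p := monProd (fun i => (X i : P5)) d
  refine ⟨p, fun m hm => ?_, ?_⟩
  · rw [homogeneousComponent_of_mem h1, if_neg (by omega)]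
  · have h4 : homogeneousComponent (n + 1) (Sq p - p - sqOne (ZMod 2) p) = 0 := by
      ext x
      rw [coeff_homogeneousComponent]
      split_ifs with hx
      · rw [mem_pow_idealOfVars_iff'] at h3
        simpa using h3 x (by omega)
      · simp
    rw [map_sub, map_sub, homogeneousComponent_of_mem h1, if_neg (by omega),
      homogeneousComponent_eq_self h2, sub_zero, sub_eq_zero] at h4
    exact h4.symm

/-- The submodule of hit polynomials of degree `n`. -/
def hitSubmodule (n : ℕ) : Submodule (ZMod 2) P5 where
  carrier := {f | IsHit n f}
  add_mem' := by
    rintro _ _ ⟨g, hg, rfl⟩ ⟨g', hg', rfl⟩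
    exact ⟨g + g', fun m hm => by simp [hg m hm, hg' m hm], by simp⟩
  zero_mem' := ⟨0, by simp, by simp⟩
  smul_mem' := by
    rintro c _ ⟨g, hg, rfl⟩
    exact ⟨c • g, fun m hm => by simp [hg m hm], by simp⟩

theorem derivation_monProd {R A : Type*} [CommRing R] [CommRing A] [Algebra R A]
    (D : Derivation R A A) (u : Fin 5 → A) (b : Fin 5 → ℕ) :
    D (monProd u b) =
      ∑ s, (b s : A) * (monProd u (fun i => b i - if i = s then 1 else 0) * D (u s)) := by
  simp only [monProd, Fin.prod_univ_five, Fin.sum_univ_five, Derivation.leibniz,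
    Derivation.leibniz_pow, smul_eq_mul, nsmul_eq_mul]
  simp
  ring

/-- If `D (y_s) = y_{s-1} ^ 2`, then `D` acts on monomials by trading. -/
theorem derivation_monProd_trade {R A : Type*} [CommRing R] [CommRing A] [Algebra R A]
    (D : Derivation R A A) (u : Fin 5 → A) (hu : ∀ s, D (u s) = u (s - 1) ^ 2) (b : Fin 5 → ℕ) :
    D (monProd u b) = ∑ s, (b s : A) * monProd u (trade b s) := by
  rw [derivation_monProd]
  refine Finset.sum_congr rfl fun s _ => ?_
  have h : u (s - 1) ^ 2 = monProd u fun i => if i = s - 1 then 2 else 0 := by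
    simp [monProd, pow_ite]
  rw [hu, h, monProd_mul]
  rfl

/-- The matrix of multiplication by `β` in the self-dual normal basis. -/
def singerMatrix : Matrix (Fin 5) (Fin 5) (ZMod 2) :=
  !![0, 1, 0, 0, 0; 1, 0, 0, 1, 0; 0, 0, 0, 1, 1; 0, 1, 1, 0, 0; 0, 0, 1, 0, 1]

theorem isUnit_det_singerMatrix : IsUnit singerMatrix.det := by
  have : singerMatrix.det = 1 := by decide +kernel
  rw [this]
  exact isUnit_one

section SelfDualBasis

variable {K : Type*} [Field K] [CharP K 2]

/-- The conjugates of the self-dual normal basis generator `β`, starting at the `n`-th one. -/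
def conjVec (β : K) (n : ℕ) (j : Fin 5) : K := β ^ 2 ^ (n + j)

theorem pow_eight_of_root {β : K} (hβ : β ^ 5 + β ^ 4 + β ^ 2 + β + 1 = 0) :
    β ^ 8 = β ^ 3 + β := by
  have h2 : (2 : K) = 0 := CharTwo.two_eq_zero
  grind

theorem pow_sixteen_of_root {β : K} (hβ : β ^ 5 + β ^ 4 + β ^ 2 + β + 1 = 0) :
    β ^ 16 = β ^ 4 + β ^ 3 + β ^ 2 + 1 := by
  have h2 : (2 : K) = 0 := CharTwo.two_eq_zero
  have h8 := pow_eight_of_root hβ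
  rw [show β ^ 16 = β ^ 8 * β ^ 8 by ring, h8]
  grind

theorem pow_thirty_two_of_root {β : K} (hβ : β ^ 5 + β ^ 4 + β ^ 2 + β + 1 = 0) :
    β ^ 32 = β := by
  have h2 : (2 : K) = 0 := CharTwo.two_eq_zero
  rw [show β ^ 32 = β ^ 16 * β ^ 16 by ring, pow_sixteen_of_root hβ]
  grind

theorem conjVec_add_five {β : K} (hβ : β ^ 5 + β ^ 4 + β ^ 2 + β + 1 = 0) (n : ℕ) :
    conjVec β (n + 5) = conjVec β n := by
  funext j
  have h : 2 ^ (n + 5 + (j : ℕ)) = 32 * 2 ^ (n + j) := by ring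
  rw [conjVec, conjVec, h, pow_mul, pow_thirty_two_of_root hβ]

theorem orderOf_of_root {β : K} (hβ : β ^ 5 + β ^ 4 + β ^ 2 + β + 1 = 0) : orderOf β = 31 := by
  have h2 : (2 : K) = 0 := CharTwo.two_eq_zero
  have h0 : β ≠ 0 := by
    rintro rfl
    simp at hβ
  have h1 : β ≠ 1 := by
    rintro rfl
    exact one_ne_zero (α := K) (by linear_combination hβ - 2 * h2)
  have : Fact (Nat.Prime 31) := ⟨by norm_num⟩
  refine orderOf_eq_prime (mul_right_cancel₀ h0 ?_) h1
  rw [← pow_succ, pow_thirty_two_of_root hβ, one_mul]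

/-- The conjugates of the generator, as polynomials of degree at most four. -/
theorem conjVec_zero {β : K} (hβ : β ^ 5 + β ^ 4 + β ^ 2 + β + 1 = 0) :
    conjVec β 0 = ![β, β ^ 2, β ^ 4, β ^ 3 + β, β ^ 4 + β ^ 3 + β ^ 2 + 1] := by
  funext j
  fin_cases j
  · simp [conjVec]
  · simp [conjVec]
  · simp [conjVec]
  · simpa [conjVec] using pow_eight_of_root hβ
  · simpa [conjVec] using pow_sixteen_of_root hβ

theorem conjVec_eq {β : K} (hβ : β ^ 5 + β ^ 4 + β ^ 2 + β + 1 = 0) (n j : Fin 5) :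
    conjVec β n j = conjVec β 0 (n + j) := by
  have h := fun k => congrFun (conjVec_add_five hβ 0) k
  rcases lt_or_ge ((n : ℕ) + j) 5 with h5 | h5
  · simp [conjVec, Fin.val_add, Nat.mod_eq_of_lt h5]
  · have h6 : ((n + j : Fin 5) : ℕ) + 5 = n + j := by
      rw [Fin.val_add, Nat.mod_eq_sub_mod h5, Nat.mod_eq_of_lt (by omega)]
      omega
    rw [← h, conjVec, conjVec, ← h6]
    ring_nf

/-- The normal basis is self-dual. -/
theorem sum_conjVec_mul {β : K} (hβ : β ^ 5 + β ^ 4 + β ^ 2 + β + 1 = 0) (i m : Fin 5) :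
    ∑ k : Fin 5, conjVec β i k * conjVec β k m = if i = m then 1 else 0 := by
  have h2 : (2 : K) = 0 := CharTwo.two_eq_zero
  simp only [conjVec_eq hβ, conjVec_zero hβ, Fin.sum_univ_five]
  fin_cases i <;> fin_cases m <;> simp <;> grind

theorem conjVec_vecMul_singerMatrix [Algebra (ZMod 2) K] {β : K}
    (hβ : β ^ 5 + β ^ 4 + β ^ 2 + β + 1 = 0) (n : Fin 5) :
    Matrix.vecMul (conjVec β n) ((algebraMap (ZMod 2) K).mapMatrix singerMatrix) =
      β ^ 2 ^ (n : ℕ) • conjVec β n := by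
  have h2 : (2 : K) = 0 := CharTwo.two_eq_zero
  have h : β ^ 2 ^ (n : ℕ) = conjVec β n 0 := by simp [conjVec]
  funext j
  rw [h]
  simp only [Matrix.vecMul, dotProduct, Pi.smul_apply, smul_eq_mul, conjVec_eq hβ,
    conjVec_zero hβ, Fin.sum_univ_five, singerMatrix, RingHom.mapMatrix_apply, Matrix.map_apply]
  fin_cases n <;> fin_cases j <;> simp <;> grind

theorem conjVec_vecMul_singerMatrix_pow [Algebra (ZMod 2) K] {β : K}
    (hβ : β ^ 5 + β ^ 4 + β ^ 2 + β + 1 = 0) (n : Fin 5) (k : ℕ) :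
    Matrix.vecMul (conjVec β n) ((algebraMap (ZMod 2) K).mapMatrix (singerMatrix ^ k)) =
      (β ^ 2 ^ (n : ℕ)) ^ k • conjVec β n := by
  induction k with
  | zero => simp
  | succ k ih =>
    rw [pow_succ, map_mul, ← Matrix.vecMul_vecMul, ih, Matrix.smul_vecMul,
      conjVec_vecMul_singerMatrix hβ, smul_smul, pow_succ]

end SelfDualBasis

theorem X_pow_thirty_two_sub_factor {R : Type*} [CommRing R] (h2 : (2 : R) = 0) (x : R) :
    x ^ 32 - x = (x ^ 5 + x ^ 4 + x ^ 2 + x + 1) *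
      (x ^ 27 + x ^ 26 + x ^ 25 + x ^ 22 + x ^ 21 + x ^ 19 + x ^ 18 + x ^ 17 + x ^ 16 + x ^ 15 +
        x ^ 13 + x ^ 9 + x ^ 6 + x ^ 4 + x ^ 2 + x) := by
  linear_combination -(x ^ 31 + x ^ 30 + x ^ 29 + x ^ 28 + 2 * x ^ 27 + 2 * x ^ 26 + x ^ 25 +
    x ^ 24 + 2 * x ^ 23 + 2 * x ^ 22 + 2 * x ^ 21 + 2 * x ^ 20 + 2 * x ^ 19 + 2 * x ^ 18 +
    2 * x ^ 17 + x ^ 16 + x ^ 15 + x ^ 14 + x ^ 13 + x ^ 11 + x ^ 10 + x ^ 9 + x ^ 8 + x ^ 7 +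
    2 * x ^ 6 + x ^ 5 + x ^ 4 + x ^ 3 + x ^ 2 + x) * h2

/-- The field with 32 elements contains a generator of a self-dual normal basis. -/
theorem exists_root_galoisField :
    ∃ β : GaloisField 2 5, β ^ 5 + β ^ 4 + β ^ 2 + β + 1 = 0 := by
  have hcard : Nat.card (GaloisField 2 5) = 32 := GaloisField.card 2 5 (by norm_num)
  let x : Polynomial (GaloisField 2 5) := Polynomial.X
  have hdeg : (x ^ 5 + x ^ 4 + x ^ 2 + x + 1).natDegree = 5 := by
    simp only [x]
    compute_degree!
  have hdvd : x ^ 5 + x ^ 4 + x ^ 2 + x + 1 ∣ x ^ 32 - x :=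
    ⟨_, X_pow_thirty_two_sub_factor CharTwo.two_eq_zero x⟩
  have hsplit : (x ^ 32 - x).Splits := by
    have h := FiniteField.splits_X_pow_nat_card_sub_X (K := GaloisField 2 5) (p := 2)
    rw [hcard] at h
    simpa using h
  have hne : x ^ 32 - x ≠ 0 :=
    FiniteField.X_pow_card_sub_X_ne_zero (GaloisField 2 5) (by norm_num)
  obtain ⟨β, hβ⟩ := (hsplit.of_dvd hne hdvd).exists_eval_eq_zero (by
    rw [Polynomial.degree_eq_natDegree (by rintro h; simp [h] at hdeg), hdeg]
    norm_num)
  exact ⟨β, by simpa [x] using hβ⟩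

section Functional

variable {K : Type*} [Field K]

theorem monProd_X_eq_monomial {R : Type*} [CommRing R] (d : Fin 5 → ℕ) :
    monProd (X : Fin 5 → MvPolynomial (Fin 5) R) d =
      monomial (Finsupp.equivFunOnFinite.symm d) 1 := by
  rw [monomial_eq, map_one, one_mul, Finsupp.prod_fintype _ _ (by simp)]
  rfl

/-- The linear forms which are eigenvectors of the Singer matrix over `F_32`. -/
def eigenform (β : K) (s : Fin 5) : MvPolynomial (Fin 5) K := ∑ j, conjVec β s j • X j

theorem sqOne_eigenform [CharP K 2] {β : K} (hβ : β ^ 5 + β ^ 4 + β ^ 2 + β + 1 = 0) (s : Fin 5) :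
    sqOne K (eigenform β s) = eigenform β (s - 1) ^ 2 := by
  have h (j : Fin 5) : conjVec β (s - 1 : Fin 5) j ^ 2 = conjVec β s j := by
    have h5 := congrFun (conjVec_add_five hβ 0) j
    have h6 (n : ℕ) : conjVec β n j ^ 2 = conjVec β (n + 1) j := by
      rw [conjVec, conjVec, ← pow_mul, ← pow_succ]
      ring_nf
    rw [h6]
    fin_cases s
    · exact h5
    all_goals rfl
  simp only [eigenform, map_sum, Derivation.map_smul, sqOne_X, CharTwo.sum_sq, smul_pow, h]

theorem X_mem_monSpan_eigenform [CharP K 2] {β : K} (hβ : β ^ 5 + β ^ 4 + β ^ 2 + β + 1 = 0)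
    (i : Fin 5) :
    (X i : MvPolynomial (Fin 5) K) ∈ monSpan K (eigenform β) fun a => ∑ i, a i = 1 := by
  have h : (X i : MvPolynomial (Fin 5) K) = ∑ k : Fin 5, conjVec β i k • eigenform β k := by
    simp only [eigenform, Finset.smul_sum, smul_smul]
    rw [Finset.sum_comm]
    simp only [← Finset.sum_smul, sum_conjVec_mul hβ]
    simp
  rw [h]
  refine Submodule.sum_mem _ fun k _ => Submodule.smul_mem _ _ ?_
  have := monProd_mem_monSpan (K := K) (eigenform β) (S := fun a => ∑ i, a i = 1)
    (a := Pi.single k 1) (by simp)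
  simpa [monProd, Pi.single_apply, pow_ite] using this

theorem eigenform_mem_monSpan_X (β : K) (s : Fin 5) :
    eigenform β s ∈ monSpan K (X : Fin 5 → MvPolynomial (Fin 5) K) fun a => ∑ i, a i = 1 := by
  refine Submodule.sum_mem _ fun k _ => Submodule.smul_mem _ _ ?_
  have := monProd_mem_monSpan (K := K) (X : Fin 5 → MvPolynomial (Fin 5) K)
    (S := fun a => ∑ i, a i = 1) (a := Pi.single k 1) (by simp)
  simpa [monProd, Pi.single_apply, pow_ite] using this

/-- Linear substitution of the variables. -/
def linSubst (M : Matrix (Fin 5) (Fin 5) K) :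
    MvPolynomial (Fin 5) K →ₐ[K] MvPolynomial (Fin 5) K :=
  aeval fun i => ∑ j, M i j • X j

theorem map_actGL [Algebra (ZMod 2) K] (g : Matrix.GeneralLinearGroup (Fin 5) (ZMod 2))
    (p : P5) :
    map (algebraMap (ZMod 2) K) (actGL g p) =
      linSubst ((algebraMap (ZMod 2) K).mapMatrix g) (map (algebraMap (ZMod 2) K) p) := by
  induction p using MvPolynomial.induction_on with
  | C a => simp [actGL, linSubst, algebraMap_eq]
  | add p q hp hq => simp only [map_add, hp, hq]
  | mul_X p i hp =>
    simp only [map_mul, hp, map_X]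
    congr 1
    simp only [actGL, linSubst, aeval_X, map_sum, smul_eq_C_mul, map_mul, map_C, map_X,
      RingHom.mapMatrix_apply, Matrix.map_apply]

theorem linSubst_monProd_eigenform [CharP K 2] [Algebra (ZMod 2) K] {β : K}
    (hβ : β ^ 5 + β ^ 4 + β ^ 2 + β + 1 = 0) (k : ℕ) (a : Fin 5 → ℕ) :
    linSubst ((algebraMap (ZMod 2) K).mapMatrix (singerMatrix ^ k)) (monProd (eigenform β) a) =
      (β ^ ∑ i : Fin 5, 2 ^ (i : ℕ) * a i) ^ k • monProd (eigenform β) a := by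
  have h (s : Fin 5) :
      linSubst ((algebraMap (ZMod 2) K).mapMatrix (singerMatrix ^ k)) (eigenform β s) =
        (β ^ 2 ^ (s : ℕ)) ^ k • eigenform β s := by
    have hv := conjVec_vecMul_singerMatrix_pow hβ s k
    set M := (algebraMap (ZMod 2) K).mapMatrix (singerMatrix ^ k)
    have hj (j : Fin 5) := congrFun hv j
    simp only [Matrix.vecMul, dotProduct, Pi.smul_apply, smul_eq_mul] at hj
    simp only [eigenform, linSubst, map_sum, map_smul, aeval_X, Finset.smul_sum, smul_smul]
    rw [Finset.sum_comm]
    simp only [← Finset.sum_smul, hj]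
  simp only [monProd, map_prod, map_pow (linSubst _), h, smul_pow]
  rw [Finset.prod_smul]
  congr 1
  rw [← Finset.prod_pow_eq_pow_sum, ← Finset.prod_pow]
  refine Finset.prod_congr rfl fun i _ => ?_
  rw [pow_mul, pow_right_comm]

/-- The extension of scalars of a linear functional. -/
def extendFunctional (K : Type*) [Field K] [Algebra (ZMod 2) K] (φ : P5 →ₗ[ZMod 2] ZMod 2) :
    MvPolynomial (Fin 5) K →ₗ[K] K :=
  (basisMonomials (Fin 5) K).constr K fun d => algebraMap (ZMod 2) K (φ (monomial d 1))

theorem extendFunctional_map [Algebra (ZMod 2) K] (φ : P5 →ₗ[ZMod 2] ZMod 2) (p : P5) :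
    extendFunctional K φ (map (algebraMap (ZMod 2) K) p) = algebraMap (ZMod 2) K (φ p) := by
  induction p using MvPolynomial.induction_on' with
  | add p q hp hq => simp only [map_add, hp, hq]
  | monomial d c =>
    have h : extendFunctional K φ (monomial d 1) = algebraMap (ZMod 2) K (φ (monomial d 1)) := by
      exact (basisMonomials (Fin 5) K).constr_basis K _ d
    have hc : (monomial d c : P5) = c • monomial d 1 := by simp [smul_monomial]
    have hc' (c : K) : (monomial d c : MvPolynomial (Fin 5) K) = c • monomial d 1 := by
      simp [smul_monomial]
    rw [map_monomial, hc', map_smul, h, hc, map_smul, smul_eq_mul, smul_eq_mul, map_mul]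

theorem map_monProd_X [Algebra (ZMod 2) K] (d : Fin 5 → ℕ) :
    map (algebraMap (ZMod 2) K) (monProd (X : Fin 5 → P5) d) =
      monProd (X : Fin 5 → MvPolynomial (Fin 5) K) d := by
  simp [monProd]

theorem sqOne_map [Algebra (ZMod 2) K] (p : P5) :
    sqOne K (map (algebraMap (ZMod 2) K) p) = map (algebraMap (ZMod 2) K) (sqOne (ZMod 2) p) := by
  induction p using MvPolynomial.induction_on with
  | C a =>
    rw [map_C, ← algebraMap_eq, ← algebraMap_eq, Derivation.map_algebraMap,
      Derivation.map_algebraMap, map_zero]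
  | add p q hp hq => simp only [map_add, hp, hq]
  | mul_X p i hp => simp [Derivation.leibniz, hp, sqOne_X]

theorem extendFunctional_eq_zero_of_lt [Algebra (ZMod 2) K] {φ : P5 →ₗ[ZMod 2] ZMod 2} {n : ℕ}
    {w : List ℕ} (hφ : ∀ p ∈ PMinus n w, φ p = 0) {p : MvPolynomial (Fin 5) K}
    (hp : p ∈ monSpan K X fun a => ∑ i, a i = n ∧ wtRel False w a) :
    extendFunctional K φ p = 0 := by
  refine (Submodule.span_le (p := LinearMap.ker (extendFunctional K φ))).2 ?_ hp
  rintro _ ⟨d, ⟨hn, hd⟩, rfl⟩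
  rw [SetLike.mem_coe, LinearMap.mem_ker, ← map_monProd_X, extendFunctional_map,
    monProd_X_eq_monomial, hφ, map_zero]
  rw [wtRel_iff] at hd
  exact Submodule.subset_span ⟨_, rfl, hn, hd.resolve_right fun h => h.1⟩

theorem extendFunctional_sqOne [Algebra (ZMod 2) K] {φ : P5 →ₗ[ZMod 2] ZMod 2} {n : ℕ}
    (hφ : ∀ p, IsHit (n + 1) p → φ p = 0) {p : MvPolynomial (Fin 5) K}
    (hp : p ∈ monSpan K X fun a => ∑ i, a i = n) :
    extendFunctional K φ (sqOne K p) = 0 := by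
  induction hp using Submodule.span_induction with
  | mem x hx =>
    obtain ⟨d, hn, rfl⟩ := hx
    rw [← map_monProd_X, sqOne_map, extendFunctional_map, hφ _ (isHit_sqOne_monProd d hn),
      map_zero]
  | zero => simp
  | add x y _ _ hx hy => rw [map_add, map_add, hx, hy, add_zero]
  | smul c x _ hx => rw [Derivation.map_smul, map_smul, hx, smul_zero]

theorem extendFunctional_monProd_eigenform [CharP K 2] [Algebra (ZMod 2) K] {β : K}
    (hβ : β ^ 5 + β ^ 4 + β ^ 2 + β + 1 = 0)
    {φ : P5 →ₗ[ZMod 2] ZMod 2} (hhit : ∀ p, IsHit 23 p → φ p = 0)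
    (hminus : ∀ p ∈ PMinus 23 [3, 4, 1, 1], φ p = 0) {a : Fin 5 → ℕ} (hsum : ∑ i, a i = 23)
    (ha : wtRel True [3, 4, 1, 1] a) (hres : 31 ∣ ∑ i : Fin 5, 2 ^ (i : ℕ) * a i) :
    extendFunctional K φ (monProd (eigenform β) a) = 0 := by
  have hlt (c : Fin 5 → ℕ) (hc : ∑ i, c i = 23) (hc' : wtRel False [3, 4, 1, 1] c) :
      extendFunctional K φ (monProd (eigenform β) c) = 0 := by
    refine extendFunctional_eq_zero_of_lt hminus ?_
    have := monProd_mem_monSpan_wtRel _ _ (eigenform_mem_monSpan_X β) False [3, 4, 1, 1] c hc'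
    rwa [hc] at this
  rw [wtRel_iff] at ha
  rcases ha with ha | ⟨-, ha⟩
  · exact hlt a hsum ((wtRel_iff _ _ _).2 (Or.inl ha))
  obtain ⟨b, q, hb, hq, hodd, hother⟩ := exists_isLeadingTrade a hsum hres (ha 0) (ha 1) (ha 2)
  have hD : extendFunctional K φ (sqOne K (monProd (eigenform β) b)) = 0 := by
    refine extendFunctional_sqOne (n := 22) hhit ?_
    have := monProd_mem_monSpan_degree _ _ (eigenform_mem_monSpan_X β) b
    rwa [hb] at this
  rw [derivation_monProd_trade _ _ (sqOne_eigenform hβ), map_sum,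
    Finset.sum_eq_single_of_mem q (Finset.mem_univ q), hq] at hD
  · have h1 : (b q : MvPolynomial (Fin 5) K) = 1 := by
      rw [← Nat.mod_add_div (b q) 2, hodd]
      push_cast
      rw [CharTwo.two_eq_zero, zero_mul, add_zero]
    rwa [h1, one_mul] at hD
  · intro s _ hs
    rcases hother s with h | h | ⟨h, h0, h1⟩
    · exact absurd h hs
    · rw [(CharP.cast_eq_zero_iff (MvPolynomial (Fin 5) K) 2 _).2 (Nat.dvd_of_mod_eq_zero h),
        zero_mul, map_zero]
    · rw [← nsmul_eq_mul, map_nsmul, hlt _ h, smul_zero]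
      rw [wtRel_iff]
      refine Or.inl ⟨1, fun j hj => ?_, h1⟩
      obtain rfl : j = 0 := by omega
      exact h0

theorem functional_eq_zero [CharP K 2] [Algebra (ZMod 2) K] {β : K}
    (hβ : β ^ 5 + β ^ 4 + β ^ 2 + β + 1 = 0)
    {φ : P5 →ₗ[ZMod 2] ZMod 2} (hhit : ∀ p, IsHit 23 p → φ p = 0)
    (hminus : ∀ p ∈ PMinus 23 [3, 4, 1, 1], φ p = 0) {f : P5} (hf : f ∈ PLe 23 [3, 4, 1, 1])
    (hinv : ∀ g, φ (actGL g f) = φ f) : φ f = 0 := by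
  refine (algebraMap (ZMod 2) K).injective ?_
  rw [map_zero, ← extendFunctional_map]
  let T : MvPolynomial (Fin 5) K →ₗ[K] K := ∑ k ∈ Finset.range 31, extendFunctional K φ ∘ₗ
    (linSubst ((algebraMap (ZMod 2) K).mapMatrix (singerMatrix ^ k))).toLinearMap
  have hT : T (map (algebraMap (ZMod 2) K) f) =
      extendFunctional K φ (map (algebraMap (ZMod 2) K) f) := by
    have hk (k : ℕ) : extendFunctional K φ
        (linSubst ((algebraMap (ZMod 2) K).mapMatrix (singerMatrix ^ k))
          (map (algebraMap (ZMod 2) K) f)) =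
        extendFunctional K φ (map (algebraMap (ZMod 2) K) f) := by
      have hg := hinv (Matrix.nonsingInvUnit singerMatrix isUnit_det_singerMatrix ^ k)
      apply_fun algebraMap (ZMod 2) K at hg
      rw [← extendFunctional_map, ← extendFunctional_map, map_actGL] at hg
      rwa [Units.val_pow_eq_pow_val] at hg
    have h2 : (2 : K) = 0 := CharTwo.two_eq_zero
    simp only [T, LinearMap.sum_apply, LinearMap.comp_apply, AlgHom.toLinearMap_apply, hk]
    rw [Finset.sum_const, Finset.card_range, nsmul_eq_mul]
    push_cast
    linear_combination 15 * extendFunctional K φ (map (algebraMap (ZMod 2) K) f) * h2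
  rw [← hT, ← LinearMap.mem_ker]
  have hmem : map (algebraMap (ZMod 2) K) f ∈
      monSpan K (eigenform β) fun a => ∑ i, a i = 23 ∧ wtRel True [3, 4, 1, 1] a := by
    clear hT hinv
    induction hf using Submodule.span_induction with
    | mem x hx =>
      obtain ⟨d, rfl, hd, hw⟩ := hx
      have := monProd_mem_monSpan_wtRel _ _ (X_mem_monSpan_eigenform hβ) True [3, 4, 1, 1] d
        ((wtRel_iff _ _ _).2 (hw.imp_right fun h => ⟨trivial, h⟩))
      rw [hd] at this
      rwa [← map_monProd_X, monProd_X_eq_monomial, Finsupp.equivFunOnFinite_symm_coe] at this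
    | zero => simp
    | add x y _ _ hx hy =>
      rw [map_add]
      exact add_mem hx hy
    | smul c x _ hx =>
      rw [smul_eq_C_mul, map_mul, map_C, ← smul_eq_C_mul]
      exact Submodule.smul_mem _ _ hx
  refine Submodule.span_le.2 ?_ hmem
  rintro _ ⟨a, ⟨hsum, ha⟩, rfl⟩
  rw [SetLike.mem_coe, LinearMap.mem_ker]
  simp only [T, LinearMap.sum_apply, LinearMap.comp_apply, AlgHom.toLinearMap_apply,
    linSubst_monProd_eigenform hβ, map_smul, smul_eq_mul]
  rw [← Finset.sum_mul]
  by_cases hres : 31 ∣ ∑ i : Fin 5, 2 ^ (i : ℕ) * a i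
  · rw [extendFunctional_monProd_eigenform hβ hhit hminus hsum ha hres, mul_zero]
  · set e := ∑ i : Fin 5, 2 ^ (i : ℕ) * a i
    have h1 : β ^ e ≠ 1 := fun h => hres (orderOf_of_root hβ ▸ orderOf_dvd_of_pow_eq_one h)
    have h31 : (β ^ e) ^ 31 = 1 := by
      rw [pow_right_comm, ← orderOf_of_root hβ, pow_orderOf_eq_one, one_pow]
    rw [geom_sum_eq h1, h31, sub_self, zero_div, zero_mul]

end Functional

/-- The GL_5-invariants of QP_5((3, 4, 1, 1)) in degree 23 vanish. -/
theorem stmt16 (f : P5) (hf : f ∈ PLe 23 [3, 4, 1, 1])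
    (hinv : ∀ g : Matrix.GeneralLinearGroup (Fin 5) (ZMod 2),
      ∃ h p : P5, IsHit 23 h ∧ p ∈ PMinus 23 [3, 4, 1, 1] ∧ actGL g f - f = h + p) :
    ∃ h p : P5, IsHit 23 h ∧ p ∈ PMinus 23 [3, 4, 1, 1] ∧ f = h + p := by
  suffices hmem : f ∈ hitSubmodule 23 ⊔ PMinus 23 [3, 4, 1, 1] by
    obtain ⟨h, hh, p, hp, rfl⟩ := Submodule.mem_sup.1 hmem
    exact ⟨h, p, hh, hp, rfl⟩
  by_contra hmem
  obtain ⟨φ, hφ, hker⟩ := Submodule.exists_le_ker_of_notMem hmem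
  obtain ⟨β, hβ⟩ := exists_root_galoisField
  have hhit (p : P5) (hp : IsHit 23 p) : φ p = 0 :=
    hker (Submodule.mem_sup_left (show p ∈ hitSubmodule 23 from hp))
  have hminus (p : P5) (hp : p ∈ PMinus 23 [3, 4, 1, 1]) : φ p = 0 :=
    hker (Submodule.mem_sup_right hp)
  refine hφ (functional_eq_zero hβ hhit hminus hf fun g => ?_)
  obtain ⟨h, p, hh, hp, hg⟩ := hinv g
  rw [← sub_eq_zero, ← map_sub, hg, map_add, hhit h hh, hminus p hp, add_zero]
end
end
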